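/- arXiv:2106.07532 — 4 statements merged into one kernel-verified Lean document; each statement's English description precedes it below -/
import Mathlib

section
/- Fix a real number p with 2 < p < ∞ and a complex number c. If a > b > 0, then ∫_{T}∫_{D} |a·w + b·z + c|^{p-2} dA(w) dm(z) < ∫_{T}∫_{D} |a·z + b·w + c|^{p-2} dA(w) dm(z), where T is the unit circle with normalized arc-length measure m, and D is the unit disc with normalized Lebesgue area measure A (so A(D)=1). -/
open MeasureTheory Complex

/-- The normalized area measure on `ℂ`, giving the unit disc total mass `1`. -/
noncomputable def discMeasure : Measure ℂ := (ENNReal.ofReal Real.pi)⁻¹ • volume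

/-- The squared distance between points at distances `r` and `k` from the origin
whose directions differ by the angle `π - x`. -/
noncomputable def cosLaw (r k x : ℝ) : ℝ := r ^ 2 + k ^ 2 + 2 * r * k * Real.cos x

lemma continuous_cosLaw (k : ℝ) : Continuous fun y : ℝ × ℝ => cosLaw y.1 k y.2 := by
  unfold cosLaw; fun_prop

lemma continuous_cosLaw_angle (r k : ℝ) : Continuous (cosLaw r k) := by
  unfold cosLaw; fun_prop

lemma sq_sub_le_cosLaw {r k : ℝ} (hr : 0 ≤ r) (hk : 0 ≤ k) (x : ℝ) :
    (k - r) ^ 2 ≤ cosLaw r k x := by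
  unfold cosLaw
  nlinarith [Real.neg_one_le_cos x, mul_nonneg hr hk]

lemma cosLaw_nonneg {r k : ℝ} (hr : 0 ≤ r) (hk : 0 ≤ k) (x : ℝ) : 0 ≤ cosLaw r k x :=
  (sq_nonneg _).trans (sq_sub_le_cosLaw hr hk x)

lemma cosLaw_pos {r k : ℝ} (hr : 0 ≤ r) (hrk : r < k) (x : ℝ) : 0 < cosLaw r k x :=
  (pow_pos (sub_pos.2 hrk) 2).trans_le (sq_sub_le_cosLaw hr (hr.trans hrk.le) x)

lemma normSq_add_circleMap (r k x : ℝ) : normSq (k + circleMap 0 r x) = cosLaw r k x := by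
  have h := Real.sin_sq_add_cos_sq x
  simp only [circleMap, zero_add, normSq_apply, add_re, add_im, ofReal_re, ofReal_im,
    re_ofReal_mul, im_ofReal_mul, exp_ofReal_mul_I_re, exp_ofReal_mul_I_im, cosLaw]
  linear_combination r ^ 2 * h

/-- The Poisson kernel has mean one over the circle. -/
lemma integral_poisson_cosLaw {r k : ℝ} (hr : 0 < r) (hrk : r < k) :
    ∫ x in 0..2 * Real.pi, (k ^ 2 - r ^ 2) / cosLaw r k x = 2 * Real.pi := by
  have hne : ∀ z ∈ Metric.closedBall (0 : ℂ) |r|, (k : ℂ) + z ≠ 0 := by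
    intro z hz h0
    have hz' : ‖z‖ ≤ r := by simpa [abs_of_pos hr] using hz
    have : z = -(k : ℂ) := by linear_combination h0
    rw [this, norm_neg, norm_real, Real.norm_of_nonneg (hr.trans hrk).le] at hz'
    linarith
  have hd : DifferentiableOn ℂ (fun z : ℂ => ((k : ℂ) - z) / (k + z))
      (Metric.closedBall 0 |r|) := by
    intro z hz
    have := hne z hz
    apply DifferentiableAt.differentiableWithinAt
    fun_prop (disch := assumption)
  have hdc : DiffContOnCl ℂ (fun z : ℂ => ((k : ℂ) - z) / (k + z)) (Metric.ball 0 |r|) := by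
    refine DifferentiableOn.diffContOnCl (hd.mono ?_)
    exact Metric.closure_ball_subset_closedBall
  have hmean := hdc.circleAverage
  have hk : (k : ℂ) ≠ 0 := by exact_mod_cast (hr.trans hrk).ne'
  have hci : CircleIntegrable (fun z : ℂ => ((k : ℂ) - z) / (k + z)) 0 r := by
    refine (hd.continuousOn.mono ?_).circleIntegrable hr.le
    rw [abs_of_pos hr]; exact Metric.sphere_subset_closedBall
  have hre := reCLM.circleAverage_comp_comm hci
  rw [hmean] at hre
  have hpt : ∀ x, (reCLM ∘ fun z : ℂ => ((k : ℂ) - z) / (k + z)) (circleMap 0 r x) =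
      (k ^ 2 - r ^ 2) / cosLaw r k x := by
    intro x
    have h := Real.sin_sq_add_cos_sq x
    simp only [Function.comp_apply, reCLM_apply, div_re, normSq_add_circleMap]
    rw [← add_div]
    congr 1
    simp only [circleMap, zero_add, add_re, add_im, sub_re, sub_im, ofReal_re, ofReal_im,
      re_ofReal_mul, im_ofReal_mul, exp_ofReal_mul_I_re, exp_ofReal_mul_I_im]
    linear_combination -r ^ 2 * h
  simp only [Real.circleAverage_def, hpt, sub_zero, add_zero, div_self hk, reCLM_apply, one_re,
    smul_eq_mul] at hre
  have := Real.pi_pos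
  field_simp at hre
  linarith

/-- Up to the factor `2π`, the mean of `‖r z + k‖ ^ (2 s)` over the unit circle. -/
noncomputable def circleMoment (s k r : ℝ) : ℝ := ∫ x in 0..2 * Real.pi, cosLaw r k x ^ s

lemma continuous_circleMoment {s : ℝ} (hs : 0 < s) (k : ℝ) : Continuous (circleMoment s k) := by
  refine intervalIntegral.continuous_parametric_intervalIntegral_of_continuous' ?_ _ _
  exact (continuous_cosLaw k).rpow_const fun _ => Or.inr hs.le

lemma continuous_cosLaw_rpow {r k : ℝ} (hr : 0 ≤ r) (hrk : r < k) (t : ℝ) :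
    Continuous fun x => cosLaw r k x ^ t :=
  (continuous_cosLaw_angle r k).rpow_const fun x => Or.inl (cosLaw_pos hr hrk x).ne'

lemma hasDerivAt_circleMoment (s : ℝ) {r k : ℝ} (hr : 0 < r) (hrk : r < k) :
    HasDerivAt (circleMoment s k)
      (∫ x in 0..2 * Real.pi, (2 * r + 2 * k * Real.cos x) * s * cosLaw r k x ^ (s - 1)) r := by
  obtain ⟨ρ, hrρ, hρk⟩ := exists_between hrk
  have hcont : ContinuousOn (fun y : ℝ × ℝ =>
      (2 * y.1 + 2 * k * Real.cos y.2) * s * cosLaw y.1 k y.2 ^ (s - 1))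
      (Set.Icc 0 ρ ×ˢ Set.Icc 0 (2 * Real.pi)) := by
    refine ContinuousOn.mul (by fun_prop) ?_
    refine (continuous_cosLaw k).continuousOn.rpow_const fun y hy => Or.inl ?_
    exact (cosLaw_pos hy.1.1 (hy.1.2.trans_lt hρk) _).ne'
  obtain ⟨B, hB⟩ := (isCompact_Icc.prod isCompact_Icc).exists_bound_of_continuousOn hcont
  refine (intervalIntegral.hasDerivAt_integral_of_dominated_loc_of_deriv_le
    (F := fun r x => cosLaw r k x ^ s) (s := Set.Ioo 0 ρ) (bound := fun _ => B)
    (F' := fun r x => (2 * r + 2 * k * Real.cos x) * s * cosLaw r k x ^ (s - 1))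
    (Ioo_mem_nhds hr hrρ) ?_ ?_ ?_ ?_ ?_ ?_).2
  · filter_upwards [Ioo_mem_nhds hr hrρ] with y hy
    exact (continuous_cosLaw_rpow hy.1.le (hy.2.trans hρk) s).aestronglyMeasurable
  · exact (continuous_cosLaw_rpow hr.le hrk s).intervalIntegrable _ _
  · exact (Continuous.mul (by fun_prop)
      (continuous_cosLaw_rpow hr.le hrk (s - 1))).aestronglyMeasurable
  · refine Filter.Eventually.of_forall fun t ht x hx => hB (x, t) ⟨⟨hx.1.le, hx.2.le⟩, ?_⟩
    rw [Set.uIoc_of_le Real.two_pi_pos.le] at ht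
    exact ⟨ht.1.le, ht.2⟩
  · exact intervalIntegrable_const
  · refine Filter.Eventually.of_forall fun t _ x hx => ?_
    have h : HasDerivAt (fun r => cosLaw r k t) (2 * x + 2 * k * Real.cos t) x := by
      unfold cosLaw
      refine ((((hasDerivAt_id x).pow 2).add_const (k ^ 2)).add
        ((((hasDerivAt_id x).const_mul 2).mul_const k).mul_const (Real.cos t))).congr_deriv ?_
      simp
    exact h.rpow_const (Or.inl (cosLaw_pos hx.1.le (hx.2.trans hρk) t).ne')

/-- The values `A ^ s` and `1 - K / A` are ordered the same way relative to `A = K`. -/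
lemma rpow_mul_one_sub_div_le {s K A : ℝ} (hs : 0 < s) (hK : 0 < K) (hA : 0 < A) :
    K ^ s * (1 - K / A) ≤ A ^ s * (1 - K / A) := by
  rcases le_total K A with h | h
  · exact mul_le_mul_of_nonneg_right (Real.rpow_le_rpow hK.le h hs.le)
      (sub_nonneg.2 ((div_le_one hA).2 h))
  · exact mul_le_mul_of_nonpos_right (Real.rpow_le_rpow hA.le h hs.le)
      (sub_nonpos.2 ((one_le_div hA).2 h))

lemma deriv_circleMoment_pos {s r k : ℝ} (hs : 0 < s) (hr : 0 < r) (hrk : r < k) :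
    0 < deriv (circleMoment s k) r := by
  rw [(hasDerivAt_circleMoment s hr hrk).deriv]
  have hK : 0 < k ^ 2 - r ^ 2 := by nlinarith
  have hpos := cosLaw_pos hr.le hrk
  have hcP : Continuous fun x => (k ^ 2 - r ^ 2) / cosLaw r k x :=
    continuous_const.div (continuous_cosLaw_angle r k) fun x => (hpos x).ne'
  have hlt : ∫ x in 0..2 * Real.pi, (k ^ 2 - r ^ 2) ^ s * (1 - (k ^ 2 - r ^ 2) / cosLaw r k x)
      < ∫ x in 0..2 * Real.pi, cosLaw r k x ^ s * (1 - (k ^ 2 - r ^ 2) / cosLaw r k x) := by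
    refine intervalIntegral.integral_lt_integral_of_continuousOn_of_le_of_exists_lt
      Real.two_pi_pos (continuous_const.mul (continuous_const.sub hcP)).continuousOn ?_
      (fun x _ => rpow_mul_one_sub_div_le hs hK (hpos x))
      ⟨0, ⟨le_rfl, Real.two_pi_pos.le⟩, ?_⟩
    · exact ((continuous_cosLaw_rpow hr.le hrk s).mul (by fun_prop)).continuousOn
    · have h : k ^ 2 - r ^ 2 < cosLaw r k 0 := by
        simp only [cosLaw, Real.cos_zero]; nlinarith [mul_pos hr (hr.trans hrk)]
      exact mul_lt_mul_of_pos_right (Real.rpow_lt_rpow hK.le h hs)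
        (sub_pos.2 ((div_lt_one (hpos 0)).2 h))
  rw [intervalIntegral.integral_const_mul, intervalIntegral.integral_sub
    intervalIntegrable_const (hcP.intervalIntegrable _ _), integral_poisson_cosLaw hr hrk,
    intervalIntegral.integral_const, smul_eq_mul, mul_one, sub_zero, sub_self, mul_zero] at hlt
  have heq : ∀ x, (2 * r + 2 * k * Real.cos x) * s * cosLaw r k x ^ (s - 1) =
      s / r * (cosLaw r k x ^ s * (1 - (k ^ 2 - r ^ 2) / cosLaw r k x)) := by
    intro x
    have := (hpos x).ne'
    rw [Real.rpow_sub_one this]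
    field_simp
    unfold cosLaw
    ring
  simp only [heq, intervalIntegral.integral_const_mul]
  positivity

lemma strictMonoOn_circleMoment {s k : ℝ} (hs : 0 < s) (hk : 0 ≤ k) :
    StrictMonoOn (circleMoment s k) (Set.Ici 0) := by
  have h₁ : StrictMonoOn (circleMoment s k) (Set.Icc 0 k) := by
    refine strictMonoOn_of_deriv_pos (convex_Icc 0 k) (continuous_circleMoment hs k).continuousOn ?_
    intro r hr
    rw [interior_Icc] at hr
    exact deriv_circleMoment_pos hs hr.1 hr.2
  have h₂ : StrictMonoOn (circleMoment s k) (Set.Ici k) := by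
    intro r hr R hR hrR
    have hr : k ≤ r := hr
    have hcont : ∀ r, ContinuousOn (fun x => cosLaw r k x ^ s) (Set.Icc 0 (2 * Real.pi)) :=
      fun r => ((continuous_cosLaw_angle r k).rpow_const fun _ => Or.inr hs.le).continuousOn
    refine intervalIntegral.integral_lt_integral_of_continuousOn_of_le_of_exists_lt
      Real.two_pi_pos (hcont r) (hcont R) (fun x _ => ?_) ⟨0, ⟨le_rfl, Real.two_pi_pos.le⟩, ?_⟩
    · refine Real.rpow_le_rpow (cosLaw_nonneg (hk.trans hr) hk x) ?_ hs.le
      unfold cosLaw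
      nlinarith [mul_nonneg (mul_nonneg (sub_nonneg.2 hrR.le) hk)
        (neg_le_iff_add_nonneg.1 (Real.neg_one_le_cos x)),
        mul_nonneg (sub_nonneg.2 hrR.le) (sub_nonneg.2 hr)]
    · refine Real.rpow_lt_rpow (cosLaw_nonneg (hk.trans hr) hk 0) ?_ hs
      simp only [cosLaw, Real.cos_zero]
      nlinarith [mul_nonneg (sub_nonneg.2 hrR.le) hk]
  rw [← Set.Icc_union_Ici_eq_Ici hk]
  exact h₁.union h₂ (isGreatest_Icc hk) isLeast_Ici

lemma norm_mul_exp_add_sq (ρ c : ℂ) (θ : ℝ) :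
    ‖ρ * exp (2 * Real.pi * I * θ) + c‖ ^ 2 =
      cosLaw ‖ρ‖ ‖c‖ (2 * Real.pi * θ + (arg ρ - arg c)) := by
  have hρ := norm_mul_exp_arg_mul_I ρ
  have hc := norm_mul_exp_arg_mul_I c
  have h : ρ * exp (2 * Real.pi * I * θ) + c = exp (arg c * I) *
      (‖c‖ + circleMap 0 ‖ρ‖ (2 * Real.pi * θ + (arg ρ - arg c))) := by
    have he : exp (arg c * I) * exp (((2 * Real.pi * θ + (arg ρ - arg c) : ℝ) : ℂ) * I) =
        exp (arg ρ * I) * exp (2 * Real.pi * I * θ) := by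
      rw [← exp_add, ← exp_add]
      push_cast
      ring_nf
    rw [circleMap]
    linear_combination -exp (2 * Real.pi * I * θ) * hρ - hc - ‖ρ‖ * he
  rw [h, norm_mul, norm_exp_ofReal_mul_I, one_mul, ← normSq_eq_norm_sq, normSq_add_circleMap]

lemma integral_norm_mul_exp_add_rpow (q : ℝ) (ρ c : ℂ) :
    ∫ θ in Set.Ioc (0 : ℝ) 1, ‖ρ * exp (2 * Real.pi * I * θ) + c‖ ^ q =
      (2 * Real.pi)⁻¹ * circleMoment (q / 2) ‖c‖ ‖ρ‖ := by
  have h : ∀ θ : ℝ, ‖ρ * exp (2 * Real.pi * I * θ) + c‖ ^ q =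
      cosLaw ‖ρ‖ ‖c‖ (2 * Real.pi * θ + (arg ρ - arg c)) ^ (q / 2) := by
    intro θ
    rw [← norm_mul_exp_add_sq, ← Real.rpow_natCast, ← Real.rpow_mul (norm_nonneg _)]
    congr 1
    push_cast
    ring
  have hper : Function.Periodic (fun x => cosLaw ‖ρ‖ ‖c‖ x ^ (q / 2)) (2 * Real.pi) := by
    intro x
    simp [cosLaw]
  simp only [h]
  rw [← intervalIntegral.integral_of_le zero_le_one,
    intervalIntegral.integral_comp_mul_add (fun x => cosLaw ‖ρ‖ ‖c‖ x ^ (q / 2))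
      Real.two_pi_pos.ne', smul_eq_mul, circleMoment]
  congr 1
  have := hper.intervalIntegral_add_eq (arg ρ - arg c) 0
  rw [zero_add] at this
  rw [← this]
  congr 1 <;> ring

/-- Integrals over the unit disc are invariant under rotation. -/
lemma setIntegral_ball_comp_mul (f : ℂ → ℝ) {u : ℂ} (hu : ‖u‖ = 1) :
    ∫ w in Metric.ball (0 : ℂ) 1, f (u * w) = ∫ w in Metric.ball (0 : ℂ) 1, f w := by
  let e : ℂ ≃ₗᵢ[ℝ] ℂ := rotation ⟨u, mem_sphere_zero_iff_norm.2 hu⟩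
  have h := e.measurePreserving.setIntegral_preimage_emb
    e.toHomeomorph.measurableEmbedding f (Metric.ball 0 1)
  have hpre : e ⁻¹' Metric.ball 0 1 = Metric.ball 0 1 := by
    ext w; simp
  rw [hpre] at h
  exact h

lemma integral_integral_norm_eq_circleMoment {q : ℝ} (hq : 0 < q) (α β : ℝ) (c : ℂ) :
    ∫ θ in Set.Ioc (0 : ℝ) 1, ∫ w in Metric.ball (0 : ℂ) 1,
        ‖(α : ℂ) * w + (β : ℂ) * exp (2 * Real.pi * I * θ) + c‖ ^ q =
      ∫ w in Metric.ball (0 : ℂ) 1, (2 * Real.pi)⁻¹ * circleMoment (q / 2) ‖c‖ ‖α * w + β‖ := by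
  have hrot : ∀ θ : ℝ, ∫ w in Metric.ball (0 : ℂ) 1,
      ‖(α : ℂ) * w + (β : ℂ) * exp (2 * Real.pi * I * θ) + c‖ ^ q =
      ∫ w in Metric.ball (0 : ℂ) 1, ‖(α * w + β) * exp (2 * Real.pi * I * θ) + c‖ ^ q := by
    intro θ
    have hu : ‖exp (2 * Real.pi * I * θ)‖ = 1 := by
      rw [show (2 * Real.pi * I * θ : ℂ) = ((2 * Real.pi * θ : ℝ) : ℂ) * I by push_cast; ring,
        norm_exp_ofReal_mul_I]
    rw [← setIntegral_ball_comp_mul _ hu]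
    congr! 4 with w
    ring
  simp only [hrot]
  rw [integral_integral_swap]
  · simp only [integral_norm_mul_exp_add_rpow]
  · rw [Measure.prod_restrict]
    have hc : Continuous (Function.uncurry fun (θ : ℝ) (w : ℂ) =>
        ‖(α * w + β) * exp (2 * Real.pi * I * θ) + c‖ ^ q) := by
      unfold Function.uncurry
      exact Continuous.rpow_const (by fun_prop) fun _ => Or.inr hq.le
    exact (hc.continuousOn.integrableOn_compact
      (isCompact_Icc.prod (isCompact_closedBall (0 : ℂ) 1))).mono_set
      (Set.prod_mono Set.Ioc_subset_Icc_self Metric.ball_subset_closedBall)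

lemma norm_mul_add_lt_norm_mul_add {a b : ℝ} (hb : 0 < b) (hab : b < a) {w : ℂ} (hw : ‖w‖ < 1) :
    ‖(a : ℂ) * w + b‖ < ‖(b : ℂ) * w + a‖ := by
  refine lt_of_pow_lt_pow_left₀ 2 (norm_nonneg _) ?_
  have hw2 : normSq w < 1 := by
    rw [normSq_eq_norm_sq]; nlinarith [norm_nonneg w]
  rw [← normSq_eq_norm_sq, ← normSq_eq_norm_sq]
  simp only [normSq_apply, add_re, add_im, re_ofReal_mul, im_ofReal_mul, ofReal_re,
    ofReal_im] at hw2 ⊢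
  nlinarith [mul_pos (mul_pos (sub_pos.2 hab) (add_pos (hb.trans hab) hb)) (sub_pos.2 hw2)]

theorem stmt_1 (p : ℝ) (hp₁ : 2 < p) (c : ℂ) (a b : ℝ) (hb : 0 < b) (hab : b < a) :
    (∫ θ in Set.Ioc (0:ℝ) 1, ∫ w in Metric.ball (0:ℂ) 1,
        ‖(a : ℂ) * w + (b : ℂ) * Complex.exp (2 * Real.pi * Complex.I * θ) + c‖ ^ (p - 2)
        ∂discMeasure)
      <
    ∫ θ in Set.Ioc (0:ℝ) 1, ∫ w in Metric.ball (0:ℂ) 1,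
        ‖(a : ℂ) * Complex.exp (2 * Real.pi * Complex.I * θ) + (b : ℂ) * w + c‖ ^ (p - 2)
        ∂discMeasure := by
  have hq : 0 < p - 2 := by linarith
  have hconst : 0 < (ENNReal.ofReal Real.pi)⁻¹.toReal := by
    rw [ENNReal.toReal_inv, ENNReal.toReal_ofReal Real.pi_pos.le]
    exact inv_pos.2 Real.pi_pos
  simp only [discMeasure, Measure.restrict_smul, integral_smul_measure, integral_smul]
  refine smul_lt_smul_of_pos_left ?_ hconst
  simp only [add_comm ((a : ℂ) * exp _)]
  rw [integral_integral_norm_eq_circleMoment hq, integral_integral_norm_eq_circleMoment hq]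
  have h_int : ∀ α β : ℝ, IntegrableOn
      (fun w : ℂ => (2 * Real.pi)⁻¹ * circleMoment ((p - 2) / 2) ‖c‖ ‖α * w + β‖)
      (Metric.ball 0 1) := by
    intro α β
    have := continuous_circleMoment (half_pos hq) ‖c‖
    exact (Continuous.continuousOn (by fun_prop)).integrableOn_compact
      (isCompact_closedBall (0 : ℂ) 1) |>.mono_set Metric.ball_subset_closedBall
  have hlt : ∀ w ∈ Metric.ball (0 : ℂ) 1,
      (2 * Real.pi)⁻¹ * circleMoment ((p - 2) / 2) ‖c‖ ‖a * w + b‖ <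
        (2 * Real.pi)⁻¹ * circleMoment ((p - 2) / 2) ‖c‖ ‖b * w + a‖ := by
    intro w hw
    refine mul_lt_mul_of_pos_left ?_ (inv_pos.2 Real.two_pi_pos)
    exact strictMonoOn_circleMoment (half_pos hq) (norm_nonneg c) (norm_nonneg _) (norm_nonneg _)
      (norm_mul_add_lt_norm_mul_add hb hab (mem_ball_zero_iff.1 hw))
  rw [← sub_pos, ← integral_sub (h_int b a) (h_int a b)]
  refine (setIntegral_pos_iff_support_of_nonneg_ae ?_ ((h_int b a).sub (h_int a b))).2 ?_
  · filter_upwards [ae_restrict_mem measurableSet_ball] with w hw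
    exact sub_nonneg.2 (hlt w hw).le
  · refine (Metric.measure_ball_pos volume (0 : ℂ) one_pos).trans_le (measure_mono fun w hw => ?_)
    exact ⟨(sub_pos.2 (hlt w hw)).ne', hw⟩
end

section
/- Fix a real number p with 1 ≤ p < ∞ and a complex number c. If a > b > 0, then a·∫_{T}∫_{D} |a·w + b·z + c|^{p-2} dA(w) dm(z) > b·∫_{T}∫_{D} |a·z + b·w + c|^{p-2} dA(w) dm(z), where T is the unit circle with normalized measure m and D the unit disc with normalized area measure A. -/
open MeasureTheory Complex

/-- The normalized length of the part of the circle `|z| = s` lying in the disc of radius `R`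
about `v`. -/
noncomputable def arcFraction (s R : ℝ) (v : ℂ) : ENNReal :=
  volume.restrict (Set.Ioc (0:ℝ) 1) {θ : ℝ | ‖v - s * exp (2 * Real.pi * I * θ)‖ < R}

lemma norm_exp_two_pi_mul_I_mul (θ : ℝ) : ‖exp (2 * Real.pi * I * θ)‖ = 1 := by
  rw [show (2 * Real.pi * I * θ : ℂ) = ((2 * Real.pi * θ : ℝ) : ℂ) * I by push_cast; ring]
  exact norm_exp_ofReal_mul_I _

lemma norm_sub_mul_exp_sq (s : ℝ) (v : ℂ) (θ : ℝ) :
    ‖v - s * exp (2 * Real.pi * I * θ)‖ ^ 2 =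
      ‖v‖ ^ 2 + s ^ 2 - 2 * ‖v‖ * s * Real.cos (2 * Real.pi * θ - arg v) := by
  have hv := norm_mul_cos_add_sin_mul_I v
  rw [← ofReal_cos, ← ofReal_sin] at hv
  have hre : v.re = ‖v‖ * Real.cos (arg v) := by
    conv_lhs => rw [← hv]
    simp
  have him : v.im = ‖v‖ * Real.sin (arg v) := by
    conv_lhs => rw [← hv]
    simp
  rw [show (2 * Real.pi * I * θ : ℂ) = ((2 * Real.pi * θ : ℝ) : ℂ) * I by push_cast; ring,
    exp_mul_I, ← ofReal_cos, ← ofReal_sin, Complex.sq_norm, normSq_apply, Real.cos_sub]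
  simp only [sub_re, sub_im, add_re, add_im, ofReal_re, ofReal_im,
    mul_re, mul_im, I_re, I_im]
  rw [hre, him]
  have h1 := Real.sin_sq_add_cos_sq (arg v)
  have h2 := Real.sin_sq_add_cos_sq (2 * Real.pi * θ)
  linear_combination ‖v‖ ^ 2 * h1 + s ^ 2 * h2

lemma volume_cos_gt (k α : ℝ) (hk₁ : -1 ≤ k) (hk₂ : k ≤ 1) :
    volume.restrict (Set.Ioc (0:ℝ) 1) {θ : ℝ | k < Real.cos (2 * Real.pi * θ - α)} =
      ENNReal.ofReal (Real.arccos k / Real.pi) := by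
  have hm : MeasurableSet {θ : ℝ | k < Real.cos (2 * Real.pi * θ - α)} :=
    measurableSet_lt measurable_const (by fun_prop)
  have hpi := Real.pi_pos
  rw [Measure.restrict_apply hm]
  have h0 := isAddFundamentalDomain_Ioc one_pos (0:ℝ) (volume : Measure ℝ)
  have h1 := isAddFundamentalDomain_Ioc one_pos (α / (2 * Real.pi) - 1 / 2) (volume : Measure ℝ)
  rw [zero_add] at h0
  rw [h0.measure_set_eq h1 hm]
  · have : {θ : ℝ | k < Real.cos (2 * Real.pi * θ - α)} ∩
        Set.Ioc (α / (2 * Real.pi) - 1 / 2) (α / (2 * Real.pi) - 1 / 2 + 1) =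
        Set.Ioo ((α - Real.arccos k) / (2 * Real.pi)) ((α + Real.arccos k) / (2 * Real.pi)) := by
      ext θ
      simp only [Set.mem_inter_iff, Set.mem_ofPred_eq, Set.mem_Ioc, Set.mem_Ioo]
      have key : ∀ x : ℝ, |x| ≤ Real.pi → (k < Real.cos x ↔ |x| < Real.arccos k) := by
        intro x hx
        rw [← Real.cos_abs x, ← Real.strictAntiOn_arccos.lt_iff_gt
          ⟨Real.neg_one_le_cos _, Real.cos_le_one _⟩ ⟨hk₁, hk₂⟩,
          Real.arccos_cos (abs_nonneg x) hx]
      have hle := Real.arccos_le_pi k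
      have e1 : α / (2 * Real.pi) - 1 / 2 = (α - Real.pi) / (2 * Real.pi) := by field_simp
      have e2 : α / (2 * Real.pi) - 1 / 2 + 1 = (α + Real.pi) / (2 * Real.pi) := by
        field_simp; ring
      rw [e2, e1, div_lt_iff₀ (by positivity), le_div_iff₀ (by positivity),
        div_lt_iff₀ (by positivity), lt_div_iff₀ (by positivity)]
      constructor
      · rintro ⟨h, h3, h4⟩
        rw [key _ (abs_le.2 ⟨by linarith, by linarith⟩), abs_lt] at h
        constructor <;> linarith
      · rintro ⟨h3, h4⟩
        refine ⟨?_, by linarith, by linarith⟩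
        rw [key _ (abs_le.2 ⟨by linarith, by linarith⟩), abs_lt]
        constructor <;> linarith
    rw [this, Real.volume_Ioo]
    congr 1
    field_simp
    ring
  · rintro ⟨g, hg⟩
    obtain ⟨n, rfl⟩ := AddSubgroup.mem_zmultiples_iff.1 hg
    ext θ
    simp only [Set.mem_preimage, Set.mem_ofPred_eq, AddSubgroup.mk_vadd, vadd_eq_add, zsmul_one]
    rw [show 2 * Real.pi * (n + θ) - α = 2 * Real.pi * θ - α + n * (2 * Real.pi) by ring,
      Real.cos_add_int_mul_two_pi]

lemma arcFraction_eq {s R : ℝ} (hs : 0 < s) (hR : 0 < R) {v : ℂ} (h₁ : |‖v‖ - s| ≤ R)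
    (h₂ : R ≤ ‖v‖ + s) (hv : 0 < ‖v‖) :
    arcFraction s R v =
      ENNReal.ofReal (Real.arccos ((‖v‖ ^ 2 + s ^ 2 - R ^ 2) / (2 * ‖v‖ * s)) / Real.pi) := by
  obtain ⟨h₃, h₄⟩ := abs_le.1 h₁
  rw [← volume_cos_gt _ (arg v), arcFraction]
  · congr 1
    ext θ
    simp only [Set.mem_ofPred_eq]
    rw [← sq_lt_sq₀ (norm_nonneg _) hR.le, norm_sub_mul_exp_sq, div_lt_iff₀ (by positivity)]
    constructor <;> intro h <;> linarith
  · rw [le_div_iff₀ (by positivity)]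
    nlinarith
  · rw [div_le_one (by positivity)]
    nlinarith

lemma arcFraction_eq_zero {s R : ℝ} (hs : 0 < s) {v : ℂ} (h : R ≤ |‖v‖ - s|) :
    arcFraction s R v = 0 := by
  rw [arcFraction]
  convert measure_empty (μ := volume.restrict (Set.Ioc (0:ℝ) 1))
  ext θ
  simp only [Set.mem_ofPred_eq, Set.mem_empty_iff_false, iff_false, not_lt]
  have := abs_norm_sub_norm_le v (s * exp (2 * Real.pi * I * θ))
  rw [norm_mul, norm_exp_two_pi_mul_I_mul, norm_real, Real.norm_of_nonneg hs.le, mul_one] at this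
  exact h.trans this

lemma arcFraction_eq_one {s R : ℝ} (hs : 0 < s) {v : ℂ} (h : ‖v‖ + s < R) :
    arcFraction s R v = 1 := by
  have : {θ : ℝ | ‖v - s * exp (2 * Real.pi * I * θ)‖ < R} = Set.univ := by
    ext θ
    simp only [Set.mem_ofPred_eq, Set.mem_univ, iff_true]
    refine (norm_sub_le _ _).trans_lt ?_
    rwa [norm_mul, norm_exp_two_pi_mul_I_mul, norm_real, Real.norm_of_nonneg hs.le, mul_one]
  rw [arcFraction, this]
  simp

lemma arcFraction_le_one (s R : ℝ) (v : ℂ) : arcFraction s R v ≤ 1 :=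
  (measure_mono (Set.subset_univ _)).trans (by simp)

/-- In a triangle with sides `a > b` and `r`, the opposite angles satisfy `B / b ≤ A / a`. -/
lemma mul_arccos_le_mul_arccos {a b r : ℝ} (hb : 0 < b) (hab : b < a) (hr : 0 < r)
    (h : |r - a| < b) :
    a * Real.arccos ((r ^ 2 + a ^ 2 - b ^ 2) / (2 * r * a)) ≤
      b * Real.arccos ((r ^ 2 + b ^ 2 - a ^ 2) / (2 * r * b)) := by
  have ha : 0 < a := hb.trans hab
  obtain ⟨h₁, h₂⟩ := abs_lt.1 h
  set x := (r ^ 2 + a ^ 2 - b ^ 2) / (2 * r * a) with hx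
  set y := (r ^ 2 + b ^ 2 - a ^ 2) / (2 * r * b) with hy
  have hyx : y ≤ x := by
    rw [hx, hy, div_le_div_iff₀ (by positivity) (by positivity)]
    nlinarith [mul_pos hr (mul_pos (sub_pos.2 hab)
      (mul_pos (show 0 < a + b - r by linarith) (show 0 < a + b + r by linarith)))]
  have hy₁ : -1 < y := by
    rw [hy, lt_div_iff₀ (by positivity)]; nlinarith
  have hy₂ : y < 1 := by
    rw [hy, div_lt_one (by positivity)]; nlinarith
  have hBA : Real.arccos x ≤ Real.arccos y := Real.antitone_arccos hyx
  have hApos : 0 < Real.arccos y := Real.arccos_pos.2 hy₂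
  have hApi : Real.arccos y < Real.pi := by
    simpa using Real.strictAntiOn_arccos (by simp) ⟨hy₁.le, hy₂.le⟩ hy₁
  have hsinA : 0 < Real.sin (Real.arccos y) := Real.sin_pos_of_pos_of_lt_pi hApos hApi
  have hsine : a * Real.sin (Real.arccos x) = b * Real.sin (Real.arccos y) := by
    have hmul : ∀ t u : ℝ, 0 ≤ t → t * √(1 - u ^ 2) = √(t ^ 2 * (1 - u ^ 2)) := by
      intro t u ht
      rw [Real.sqrt_mul (sq_nonneg t), Real.sqrt_sq ht]
    rw [Real.sin_arccos, Real.sin_arccos, hmul a x ha.le, hmul b y hb.le]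
    congr 1
    rw [hx, hy]
    field_simp
    ring
  have hconc : Real.arccos x * Real.sin (Real.arccos y) ≤
      Real.arccos y * Real.sin (Real.arccos x) := by
    have := strictConcaveOn_sin_Icc.concaveOn.2
      (show Real.arccos y ∈ Set.Icc 0 Real.pi from ⟨hApos.le, hApi.le⟩)
      (show (0:ℝ) ∈ Set.Icc 0 Real.pi from ⟨le_rfl, Real.pi_pos.le⟩)
      (div_nonneg (Real.arccos_nonneg x) hApos.le)
      (sub_nonneg.2 ((div_le_one hApos).2 hBA)) (add_sub_cancel _ _)
    simp only [smul_eq_mul, Real.sin_zero, mul_zero, add_zero, div_mul_cancel₀ _ hApos.ne'] at this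
    rwa [div_mul_eq_mul_div, div_le_iff₀ hApos, mul_comm (Real.sin _)] at this
  refine le_of_mul_le_mul_right ?_ hsinA
  calc a * Real.arccos x * Real.sin (Real.arccos y)
      = a * (Real.arccos x * Real.sin (Real.arccos y)) := by ring
    _ ≤ a * (Real.arccos y * Real.sin (Real.arccos x)) := by gcongr
    _ = Real.arccos y * (a * Real.sin (Real.arccos x)) := by ring
    _ = b * Real.arccos y * Real.sin (Real.arccos y) := by rw [hsine]; ring

lemma ofReal_mul_arcFraction_le {a b : ℝ} (hb : 0 < b) (hab : b < a) (v : ℂ) :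
    ENNReal.ofReal a * arcFraction a b v ≤ ENNReal.ofReal b * arcFraction b a v := by
  have ha : 0 < a := hb.trans hab
  rcases le_or_gt b |‖v‖ - a| with h | h
  · rw [arcFraction_eq_zero ha h]; simp
  · obtain ⟨h₁, h₂⟩ := abs_lt.1 h
    have hr : 0 < ‖v‖ := by linarith
    rw [arcFraction_eq ha hb h.le (by linarith) hr,
      arcFraction_eq hb ha (abs_le.2 ⟨by linarith, by linarith⟩) (by linarith) hr,
      ← ENNReal.ofReal_mul ha.le, ← ENNReal.ofReal_mul hb.le]
    apply ENNReal.ofReal_le_ofReal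
    rw [← mul_div_assoc, ← mul_div_assoc]
    gcongr ?_ / _
    exact mul_arccos_le_mul_arccos hb hab hr h

lemma lintegral_comp_ofReal_mul_add {f : ℂ → ENNReal} (hf : Measurable f) {R : ℝ} (hR : 0 < R)
    (x : ℂ) : ∫⁻ w, f (R * w + x) = ENNReal.ofReal (R ^ 2)⁻¹ * ∫⁻ v, f v := by
  calc ∫⁻ w, f (R * w + x) = ∫⁻ w : ℂ, f (R • w + x) := by simp only [real_smul]
    _ = ∫⁻ v, f (v + x) ∂(Measure.map (fun w : ℂ => R • w) volume) :=
        (lintegral_map (f := fun v => f (v + x)) (by fun_prop) (by fun_prop)).symm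
    _ = ENNReal.ofReal (R ^ 2)⁻¹ * ∫⁻ v, f v := by
        rw [Measure.map_addHaar_smul _ hR.ne', finrank_real_complex, lintegral_smul_measure,
          lintegral_add_right_eq_self, abs_of_pos (by positivity), smul_eq_mul]

lemma setLIntegral_ball_discMeasure {f : ℂ → ENNReal} (hf : Measurable f) {R : ℝ} (hR : 0 < R)
    (x c : ℂ) :
    ∫⁻ w in Metric.ball 0 1, f (R * w + x + c) ∂discMeasure =
      (ENNReal.ofReal Real.pi)⁻¹ * ENNReal.ofReal (R ^ 2)⁻¹ *
        ∫⁻ v in Metric.ball x R, f (v + c) := by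
  rw [discMeasure, Measure.restrict_smul, lintegral_smul_measure, smul_eq_mul, mul_assoc,
    ← lintegral_indicator Metric.isOpen_ball.measurableSet,
    ← lintegral_indicator Metric.isOpen_ball.measurableSet,
    ← lintegral_comp_ofReal_mul_add (f := (Metric.ball x R).indicator fun v => f (v + c))
      ((hf.comp (measurable_add_const c)).indicator Metric.isOpen_ball.measurableSet) hR x]
  congr 2
  ext w
  simp only [Set.indicator, Metric.mem_ball, dist_eq_norm, sub_zero, add_sub_cancel_right,
    norm_mul, norm_real, Real.norm_of_nonneg hR.le]
  simp only [mul_lt_iff_lt_one_right hR]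

lemma lintegral_circle_disc_eq {f : ℂ → ENNReal} (hf : Measurable f) (s : ℝ) {R : ℝ}
    (hR : 0 < R) (c : ℂ) :
    ∫⁻ θ in Set.Ioc (0:ℝ) 1, ∫⁻ w in Metric.ball (0:ℂ) 1,
        f (R * w + s * exp (2 * Real.pi * I * θ) + c) ∂discMeasure =
      (ENNReal.ofReal Real.pi)⁻¹ * ENNReal.ofReal (R ^ 2)⁻¹ *
        ∫⁻ v, arcFraction s R v * f (v + c) := by
  have hS : MeasurableSet {q : ℝ × ℂ | ‖q.2 - s * exp (2 * Real.pi * I * q.1)‖ < R} :=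
    (isOpen_lt (by fun_prop) continuous_const).measurableSet
  have hF : Measurable ({q : ℝ × ℂ | ‖q.2 - s * exp (2 * Real.pi * I * q.1)‖ < R}.indicator
      fun q => f (q.2 + c)) := by
    exact (hf.comp (by fun_prop)).indicator hS
  simp only [setLIntegral_ball_discMeasure hf hR]
  rw [lintegral_const_mul']
  · congr 1
    calc ∫⁻ θ in Set.Ioc (0:ℝ) 1, ∫⁻ v in Metric.ball (s * exp (2 * Real.pi * I * θ)) R, f (v + c)
        = ∫⁻ θ in Set.Ioc (0:ℝ) 1, ∫⁻ v,
            ({q : ℝ × ℂ | ‖q.2 - s * exp (2 * Real.pi * I * q.1)‖ < R}.indicator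
              fun q => f (q.2 + c)) (θ, v) := by
          congr 1
          ext θ
          rw [← lintegral_indicator Metric.isOpen_ball.measurableSet]
          simp only [Set.indicator, Metric.mem_ball, dist_eq_norm, Set.mem_ofPred_eq]
      _ = ∫⁻ v, ∫⁻ θ in Set.Ioc (0:ℝ) 1,
            ({q : ℝ × ℂ | ‖q.2 - s * exp (2 * Real.pi * I * q.1)‖ < R}.indicator
              fun q => f (q.2 + c)) (θ, v) := lintegral_lintegral_swap hF.aemeasurable
      _ = ∫⁻ v, arcFraction s R v * f (v + c) := by
          congr 1
          ext v
          rw [arcFraction, mul_comm _ (f (v + c)), ← lintegral_indicator_const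
            (isOpen_lt (by fun_prop) continuous_const).measurableSet]
          rfl
  · finiteness [Real.pi_pos]

lemma measurable_arcFraction (s R : ℝ) : Measurable (arcFraction s R) :=
  measurable_measure_prodMk_right (μ := volume.restrict (Set.Ioc (0:ℝ) 1))
    (s := {q : ℝ × ℂ | ‖q.2 - s * exp (2 * Real.pi * I * q.1)‖ < R})
    (isOpen_lt (by fun_prop) continuous_const).measurableSet

lemma lintegral_arcFraction_mul_lt_top {f : ℂ → ENNReal}
    (hf : ∀ x r, ∫⁻ v in Metric.ball x r, f v < ⊤) {s : ℝ} (hs : 0 < s) (R : ℝ) (c : ℂ) :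
    ∫⁻ v, arcFraction s R v * f (v + c) < ⊤ := by
  refine lt_of_le_of_lt ?_ (hf c (R + s))
  rw [← lintegral_indicator Metric.isOpen_ball.measurableSet,
    ← lintegral_add_right_eq_self (Set.indicator _ _) c]
  refine lintegral_mono fun v => ?_
  by_cases hv : ‖v‖ < R + s
  · rw [Set.indicator_of_mem (by simpa using hv)]
    exact mul_le_of_le_one_left' (arcFraction_le_one s R v)
  · rw [arcFraction_eq_zero hs (le_trans (by linarith) (le_abs_self _)), zero_mul]
    exact zero_le

lemma integral_circle_disc_eq {f : ℂ → ℝ} (hfm : Measurable f) (hf₀ : ∀ v, 0 ≤ f v)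
    (hf : ∀ x r, ∫⁻ v in Metric.ball x r, ENNReal.ofReal (f v) < ⊤) (s : ℝ) {R : ℝ}
    (hR : 0 < R) (c : ℂ) :
    ∫ θ in Set.Ioc (0:ℝ) 1, ∫ w in Metric.ball (0:ℂ) 1,
        f (R * w + s * exp (2 * Real.pi * I * θ) + c) ∂discMeasure =
      (Real.pi * R ^ 2)⁻¹ * (∫⁻ v, arcFraction s R v * ENNReal.ofReal (f (v + c))).toReal := by
  have hfm' : Measurable fun v => ENNReal.ofReal (f v) := hfm.ennreal_ofReal
  have hinner : ∀ θ : ℝ, ∫ w in Metric.ball (0:ℂ) 1,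
        f (R * w + s * exp (2 * Real.pi * I * θ) + c) ∂discMeasure =
      (∫⁻ w in Metric.ball (0:ℂ) 1,
        ENNReal.ofReal (f (R * w + s * exp (2 * Real.pi * I * θ) + c)) ∂discMeasure).toReal := by
    intro θ
    exact integral_eq_lintegral_of_nonneg_ae (.of_forall fun w => hf₀ _)
      (hfm.comp (by fun_prop)).aestronglyMeasurable
  simp only [hinner]
  have : SFinite discMeasure := by unfold discMeasure; infer_instance
  rw [integral_toReal, lintegral_circle_disc_eq hfm' s hR, ENNReal.toReal_mul, ENNReal.toReal_mul,
    ENNReal.toReal_inv, ENNReal.toReal_ofReal Real.pi_pos.le,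
    ENNReal.toReal_ofReal (by positivity), mul_inv]
  · refine (Measurable.lintegral_prod_right' (f := fun q : ℝ × ℂ =>
      ENNReal.ofReal (f (R * q.2 + s * exp (2 * Real.pi * I * q.1) + c))) ?_).aemeasurable
    exact hfm'.comp (by fun_prop)
  · refine .of_forall fun θ => ?_
    rw [setLIntegral_ball_discMeasure hfm' hR]
    refine ENNReal.mul_lt_top (by finiteness [Real.pi_pos]) ?_
    refine lt_of_le_of_lt (le_of_eq ?_) (hf (s * exp (2 * Real.pi * I * θ) + c) R)
    rw [← lintegral_indicator Metric.isOpen_ball.measurableSet,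
      ← lintegral_indicator Metric.isOpen_ball.measurableSet,
      ← lintegral_add_right_eq_self (Set.indicator (Metric.ball (_ + c) R) _) c]
    congr 1
    ext v
    simp only [Set.indicator, Metric.mem_ball, dist_add_right]

lemma setLIntegral_ball_norm_rpow_lt_top {q : ℝ} (hq : -2 < q) (x : ℂ) (r : ℝ) :
    ∫⁻ v in Metric.ball x r, ENNReal.ofReal (‖v‖ ^ q) < ⊤ := by
  have hloc : LocallyIntegrable (fun v : ℂ => ‖v‖ ^ q) volume := by
    refine locallyIntegrable_of_norm_le_rpow (C := 1) (α := -q) (by simp) ?_ ?_ ?_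
    · rw [finrank_real_complex]; push_cast; linarith
    · refine .of_forall fun v => ?_
      rw [Real.norm_of_nonneg (by positivity), neg_neg, one_mul]
    · exact (measurable_norm.pow_const q).aestronglyMeasurable
  exact ((hloc.integrableOn_isCompact (isCompact_closedBall x r)).mono_set
    Metric.ball_subset_closedBall).lintegral_lt_top

theorem stmt_2 (p : ℝ) (hp₁ : 1 ≤ p) (c : ℂ) (a b : ℝ) (hb : 0 < b) (hab : b < a) :
    b * (∫ θ in Set.Ioc (0:ℝ) 1, ∫ w in Metric.ball (0:ℂ) 1,
        ‖(a : ℂ) * Complex.exp (2 * Real.pi * Complex.I * θ) + (b : ℂ) * w + c‖ ^ (p - 2)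
        ∂discMeasure)
      <
    a * ∫ θ in Set.Ioc (0:ℝ) 1, ∫ w in Metric.ball (0:ℂ) 1,
        ‖(a : ℂ) * w + (b : ℂ) * Complex.exp (2 * Real.pi * Complex.I * θ) + c‖ ^ (p - 2)
        ∂discMeasure := by
  have ha : 0 < a := hb.trans hab
  have hfm : Measurable fun v : ℂ => ‖v‖ ^ (p - 2) := measurable_norm.pow_const _
  have hf₀ : ∀ v : ℂ, 0 ≤ ‖v‖ ^ (p - 2) := fun v => by positivity
  have hf := setLIntegral_ball_norm_rpow_lt_top (q := p - 2) (by linarith)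
  simp only [add_comm ((a : ℂ) * Complex.exp _)]
  rw [integral_circle_disc_eq hfm hf₀ hf a hb c, integral_circle_disc_eq hfm hf₀ hf b ha c]
  have hfin₁ := lintegral_arcFraction_mul_lt_top hf ha b c
  have hfin₂ := lintegral_arcFraction_mul_lt_top hf hb a c
  have hlt : ENNReal.ofReal a * ∫⁻ v, arcFraction a b v * ENNReal.ofReal (‖v + c‖ ^ (p - 2)) <
      ENNReal.ofReal b * ∫⁻ v, arcFraction b a v * ENNReal.ofReal (‖v + c‖ ^ (p - 2)) := by
    have hmeas : Measurable fun v : ℂ => ENNReal.ofReal (‖v + c‖ ^ (p - 2)) := by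
      fun_prop
    have hfin := ENNReal.mul_ne_top (ENNReal.ofReal_ne_top (r := a)) hfin₁.ne
    rw [← lintegral_const_mul' _ _ ENNReal.ofReal_ne_top] at hfin ⊢
    rw [← lintegral_const_mul' _ _ ENNReal.ofReal_ne_top]
    refine lintegral_strict_mono_of_ae_le_of_ae_lt_on (s := Metric.ball 0 (a - b))
      (((measurable_arcFraction b a).mul hmeas).const_mul _).aemeasurable hfin
      (.of_forall fun v => ?_) (Metric.measure_ball_pos _ _ (sub_pos.2 hab)).ne' ?_
    · simp only [← mul_assoc]
      gcongr ?_ * _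
      exact ofReal_mul_arcFraction_le hb hab v
    · filter_upwards [compl_mem_ae_iff.2 (measure_singleton (-c))] with v hv hvb
      rw [mem_ball_zero_iff] at hvb
      have hva : b ≤ |‖v‖ - a| := by
        rw [abs_sub_comm]
        exact le_trans (by linarith) (le_abs_self _)
      rw [arcFraction_eq_zero ha hva, arcFraction_eq_one hb (by linarith)]
      have hvc : 0 < ‖v + c‖ := norm_pos_iff.2 fun h => hv (eq_neg_of_add_eq_zero_left h)
      simp only [zero_mul, mul_zero, one_mul]
      exact ENNReal.mul_pos (by simpa using hb) (by simpa using Real.rpow_pos_of_pos hvc _)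
  have hreal := ENNReal.toReal_strict_mono (ENNReal.mul_ne_top ENNReal.ofReal_ne_top hfin₂.ne) hlt
  rw [ENNReal.toReal_mul, ENNReal.toReal_mul, ENNReal.toReal_ofReal ha.le,
    ENNReal.toReal_ofReal hb.le] at hreal
  have hpos : 0 < (Real.pi * a * b)⁻¹ := by have := Real.pi_pos; positivity
  calc b * ((Real.pi * b ^ 2)⁻¹ * _) = (Real.pi * a * b)⁻¹ * (a * _) := by field_simp
    _ < (Real.pi * a * b)⁻¹ * (b * _) := mul_lt_mul_of_pos_left hreal hpos
    _ = a * ((Real.pi * a ^ 2)⁻¹ * _) := by field_simp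
end

section
/- Khintchin's inequality for Steinhaus variables, upper bound: for real p with 2 < p < ∞ and complex numbers c₁,…,c_d, (∫_{T^d} |c₁z₁+⋯+c_dz_d|^p dm_d)^{1/p} ≤ Γ(1+p/2)^{1/p} · (Σ_{j=1}^d |c_j|²)^{1/2}. -/
open MeasureTheory Filter Topology

/-- Differentiation under the integral sign for a jointly continuous derivative. -/
theorem hasDerivAt_intervalIntegral_of_continuous {F F' : ℝ → ℝ → ℝ}
    (hF : ∀ t θ, HasDerivAt (fun s => F s θ) (F' t θ) t) (hFc : ∀ t, Continuous (F t))
    (hF' : Continuous (Function.uncurry F')) (t : ℝ) :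
    HasDerivAt (fun s => ∫ θ in (0 : ℝ)..1, F s θ) (∫ θ in (0 : ℝ)..1, F' t θ) t := by
  obtain ⟨C, hC⟩ := ((isCompact_closedBall t 1).prod
    (isCompact_Icc (a := (0 : ℝ)) (b := 1))).exists_bound_of_continuousOn hF'.continuousOn
  refine (intervalIntegral.hasDerivAt_integral_of_dominated_loc_of_deriv_le
    (bound := fun _ => C) (Metric.ball_mem_nhds t one_pos) ?_ ?_ ?_ ?_ ?_ ?_).2
  · exact Eventually.of_forall fun s => (hFc s).aestronglyMeasurable
  · exact (hFc t).intervalIntegrable _ _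
  · exact (hF'.comp (Continuous.prodMk_right t)).aestronglyMeasurable
  · refine Eventually.of_forall fun θ hθ s hs => ?_
    rw [Set.uIoc_of_le zero_le_one] at hθ
    exact hC (s, θ) ⟨Metric.ball_subset_closedBall hs, Set.Ioc_subset_Icc_self hθ⟩
  · exact intervalIntegrable_const
  · exact Eventually.of_forall fun θ _ s _ => hF s θ

/-- `‖A + B r e^{2πiθ}‖²` for real `A`, `B`, `r`. -/
noncomputable def sqDist (A B r θ : ℝ) : ℝ :=
  A ^ 2 + B ^ 2 * r ^ 2 + 2 * A * B * r * Real.cos (2 * Real.pi * θ)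

theorem sqDist_nonneg (A B r θ : ℝ) : 0 ≤ sqDist A B r θ := by
  have h : sqDist A B r θ = (A + B * r * Real.cos (2 * Real.pi * θ)) ^ 2
      + (B * r * Real.sin (2 * Real.pi * θ)) ^ 2 := by
    rw [sqDist]
    linear_combination (-(B * r) ^ 2) * Real.sin_sq_add_cos_sq (2 * Real.pi * θ)
  rw [h]
  positivity

theorem continuous_sqDist (A B : ℝ) : Continuous fun x : ℝ × ℝ => sqDist A B x.1 x.2 := by
  unfold sqDist
  fun_prop

theorem continuous_comp_sqDist {H : ℝ → ℝ} (hH : ContinuousOn H (Set.Ici 0)) (A B : ℝ) :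
    Continuous fun x : ℝ × ℝ => H (sqDist A B x.1 x.2) :=
  hH.comp_continuous (continuous_sqDist A B) fun x => sqDist_nonneg A B x.1 x.2

/-- Mean over the circle of radius `B e^{t/2}` about `A` of the radial function `H (‖·‖²)`. -/
noncomputable def circleMean (H : ℝ → ℝ) (A B t : ℝ) : ℝ :=
  ∫ θ in (0 : ℝ)..1, H (sqDist A B (Real.exp (t / 2)) θ)

/-- The derivative in `t` of `circleMean H A B t`, in terms of the derivative `H'` of `H`. -/
noncomputable def circleMeanDeriv (H' : ℝ → ℝ) (A B t : ℝ) : ℝ :=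
  ∫ θ in (0 : ℝ)..1, H' (sqDist A B (Real.exp (t / 2)) θ) *
    (B ^ 2 * Real.exp (t / 2) ^ 2 + A * B * Real.exp (t / 2) * Real.cos (2 * Real.pi * θ))

theorem hasDerivAt_exp_half (t : ℝ) :
    HasDerivAt (fun s : ℝ => Real.exp (s / 2)) (Real.exp (t / 2) / 2) t := by
  simpa [div_eq_mul_inv] using ((hasDerivAt_id t).div_const 2).exp

theorem hasDerivAt_sqDist_exp (A B t θ : ℝ) :
    HasDerivAt (fun s => sqDist A B (Real.exp (s / 2)) θ)
      (B ^ 2 * Real.exp (t / 2) ^ 2 + A * B * Real.exp (t / 2) * Real.cos (2 * Real.pi * θ)) t := by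
  unfold sqDist
  have h := hasDerivAt_exp_half t
  refine ((((h.pow 2).const_mul (B ^ 2)).const_add (A ^ 2)).add
    ((h.const_mul (2 * A * B)).mul_const (Real.cos (2 * Real.pi * θ)))).congr_deriv ?_
  simp only [Nat.cast_ofNat]
  ring

theorem hasDerivAt_two_pi_mul (θ : ℝ) :
    HasDerivAt (fun s : ℝ => 2 * Real.pi * s) (2 * Real.pi) θ := by
  simpa using (hasDerivAt_id θ).const_mul (2 * Real.pi)

theorem hasDerivAt_sqDist_angle (A B r θ : ℝ) :
    HasDerivAt (fun s => sqDist A B r s)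
      (-(4 * Real.pi * A * B * r * Real.sin (2 * Real.pi * θ))) θ := by
  unfold sqDist
  refine (((hasDerivAt_two_pi_mul θ).cos.const_mul (2 * A * B * r)).const_add _).congr_deriv ?_
  ring

theorem hasDerivAt_circleMean {H H' : ℝ → ℝ} (hH : ∀ x, 0 ≤ x → HasDerivAt H (H' x) x)
    (hH' : ContinuousOn H' (Set.Ici 0)) (A B t : ℝ) :
    HasDerivAt (circleMean H A B) (circleMeanDeriv H' A B t) t := by
  have hHc : ContinuousOn H (Set.Ici 0) := fun x hx => (hH x hx).continuousAt.continuousWithinAt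
  refine hasDerivAt_intervalIntegral_of_continuous (fun t θ =>
    (hH _ (sqDist_nonneg A B (Real.exp (t / 2)) θ)).comp t (hasDerivAt_sqDist_exp A B t θ)) (fun s => ?_) ?_ t
  · exact (continuous_comp_sqDist hHc A B).comp
      (by fun_prop : Continuous fun θ : ℝ => (Real.exp (s / 2), θ))
  · refine Continuous.mul ?_ (by fun_prop)
    exact (continuous_comp_sqDist hH' A B).comp
      (by fun_prop : Continuous fun x : ℝ × ℝ => (Real.exp (x.1 / 2), x.2))

theorem integral_deriv_angle_eq_zero {H' H'' : ℝ → ℝ} (hH' : ∀ x, 0 ≤ x → HasDerivAt H' (H'' x) x)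
    (hH'' : ContinuousOn H'' (Set.Ici 0)) (A B r : ℝ) :
    ∫ θ in (0 : ℝ)..1, (H'' (sqDist A B r θ) * (A * B * r * Real.sin (2 * Real.pi * θ)) ^ 2
      - H' (sqDist A B r θ) * (A * B * r * Real.cos (2 * Real.pi * θ)) / 2) = 0 := by
  have hH'c : ContinuousOn H' (Set.Ici 0) := fun x hx => (hH' x hx).continuousAt.continuousWithinAt
  have hd : ∀ θ, HasDerivAt (fun s => -(H' (sqDist A B r s) *
      (A * B * r * Real.sin (2 * Real.pi * s))) / (4 * Real.pi))
      (H'' (sqDist A B r θ) * (A * B * r * Real.sin (2 * Real.pi * θ)) ^ 2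
      - H' (sqDist A B r θ) * (A * B * r * Real.cos (2 * Real.pi * θ)) / 2) θ := fun θ => by
    refine ((((hH' _ (sqDist_nonneg A B r θ)).comp θ (hasDerivAt_sqDist_angle A B r θ)).mul
      ((hasDerivAt_two_pi_mul θ).sin.const_mul (A * B * r))).neg.div_const
        (4 * Real.pi)).congr_deriv ?_
    have := Real.pi_ne_zero
    simp only [Function.comp]
    field_simp
    ring
  rw [intervalIntegral.integral_eq_sub_of_hasDerivAt (fun θ _ => hd θ)]
  · simp
  · refine Continuous.intervalIntegrable ?_ _ _
    have h1 := (continuous_comp_sqDist hH'c A B).comp (by fun_prop : Continuous fun θ : ℝ => (r, θ))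
    have h2 := (continuous_comp_sqDist hH'' A B).comp (by fun_prop : Continuous fun θ : ℝ => (r, θ))
    exact (h2.mul (by fun_prop)).sub ((h1.mul (by fun_prop)).div_const 2)

/-- The polar form of the Laplacian, averaged over circles. -/
theorem hasDerivAt_circleMeanDeriv {H' H'' : ℝ → ℝ}
    (hH' : ∀ x, 0 ≤ x → HasDerivAt H' (H'' x) x)
    (hH'' : ContinuousOn H'' (Set.Ici 0)) (A B t : ℝ) :
    HasDerivAt (circleMeanDeriv H' A B)
      (B ^ 2 * Real.exp t * circleMean (fun x => x * H'' x + H' x) A B t) t := by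
  have hH'c : ContinuousOn H' (Set.Ici 0) := fun x hx => (hH' x hx).continuousAt.continuousWithinAt
  have hr : ∀ s : ℝ, Continuous fun θ : ℝ => (Real.exp (s / 2), θ) := fun s => by fun_prop
  have hr' : Continuous fun x : ℝ × ℝ => (Real.exp (x.1 / 2), x.2) := by fun_prop
  have h1 := fun s => (continuous_comp_sqDist hH'c A B).comp (hr s)
  have h2 := fun s => (continuous_comp_sqDist hH'' A B).comp (hr s)
  have h1' := (continuous_comp_sqDist hH'c A B).comp hr'
  have h2' := (continuous_comp_sqDist hH'' A B).comp hr'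
  have h0 := fun s => (continuous_sqDist A B).comp (hr s)
  have hw : ∀ s θ, HasDerivAt (fun s => B ^ 2 * Real.exp (s / 2) ^ 2 +
      A * B * Real.exp (s / 2) * Real.cos (2 * Real.pi * θ))
      (B ^ 2 * Real.exp (s / 2) ^ 2 + A * B * Real.exp (s / 2) * Real.cos (2 * Real.pi * θ) / 2)
      s := fun s θ => by
    have h := hasDerivAt_exp_half s
    refine (((h.pow 2).const_mul (B ^ 2)).add
      ((h.const_mul (A * B)).mul_const (Real.cos (2 * Real.pi * θ)))).congr_deriv ?_
    simp only [Nat.cast_ofNat]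
    ring
  refine (hasDerivAt_intervalIntegral_of_continuous (fun s θ =>
    ((hH' _ (sqDist_nonneg A B (Real.exp (s / 2)) θ)).comp s (hasDerivAt_sqDist_exp A B s θ)).mul (hw s θ))
    (fun s => ?_) ?_ t).congr_deriv ?_
  · exact (h1 s).mul (by fun_prop)
  · exact ((h2'.mul (by fun_prop)).mul (by fun_prop)).add (h1'.mul (by fun_prop))
  · rw [circleMean, ← intervalIntegral.integral_const_mul, eq_comm, ← sub_eq_zero,
      ← intervalIntegral.integral_sub]
    rotate_left
    · refine Continuous.intervalIntegrable ?_ _ _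
      exact (((h0 t).mul (h2 t)).add (h1 t)).const_mul _
    · refine Continuous.intervalIntegrable ?_ _ _
      exact (((h2 t).mul (by fun_prop)).mul (by fun_prop)).add ((h1 t).mul (by fun_prop))
    · refine (intervalIntegral.integral_congr fun θ _ => ?_).trans
        (integral_deriv_angle_eq_zero hH' hH'' A B (Real.exp (t / 2)))
      have he : Real.exp t = Real.exp (t / 2) ^ 2 := by
        rw [← Real.exp_nat_mul]; congr 1; push_cast; ring
      simp only [Function.comp, he]
      have hs := Real.sin_sq_add_cos_sq (2 * Real.pi * θ)
      generalize H'' _ = x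
      generalize H' _ = y
      rw [sqDist]
      linear_combination (-x * (A * B * Real.exp (t / 2)) ^ 2) * hs

theorem tendsto_exp_half_atBot : Tendsto (fun t : ℝ => Real.exp (t / 2)) atBot (𝓝 0) :=
  Real.tendsto_exp_atBot.comp (tendsto_id.atBot_div_const two_pos)

theorem tendsto_circleMeanDeriv_atBot {H' : ℝ → ℝ} (hH' : ContinuousOn H' (Set.Ici 0)) (A B : ℝ) :
    Tendsto (circleMeanDeriv H' A B) atBot (𝓝 0) := by
  have hc : Continuous fun r : ℝ => ∫ θ in (0 : ℝ)..1, H' (sqDist A B r θ) *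
      (B ^ 2 * r ^ 2 + A * B * r * Real.cos (2 * Real.pi * θ)) := by
    refine intervalIntegral.continuous_parametric_intervalIntegral_of_continuous' ?_ 0 1
    refine Continuous.mul (continuous_comp_sqDist hH' A B) (by fun_prop)
  have hlim := (hc.tendsto 0).comp tendsto_exp_half_atBot
  simp only [ne_eq, OfNat.ofNat_ne_zero, not_false_eq_true, zero_pow, mul_zero, zero_mul, add_zero,
    intervalIntegral.integral_zero] at hlim
  exact hlim

theorem tendsto_exp_mul_circleMean_atBot {H : ℝ → ℝ} (hH : ContinuousOn H (Set.Ici 0)) (A B : ℝ) :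
    Tendsto (fun t => B ^ 2 * Real.exp t * circleMean H A B t) atBot (𝓝 0) := by
  have hc : Continuous fun r : ℝ => ∫ θ in (0 : ℝ)..1, H (sqDist A B r θ) :=
    intervalIntegral.continuous_parametric_intervalIntegral_of_continuous'
      (continuous_comp_sqDist hH A B) 0 1
  have := (Real.tendsto_exp_atBot.const_mul (B ^ 2)).mul
    ((hc.tendsto 0).comp tendsto_exp_half_atBot)
  simpa [Function.comp_def, circleMean] using this

theorem nonneg_of_deriv_nonneg_of_tendsto_atBot {f f' : ℝ → ℝ} (hf : ∀ t, HasDerivAt f (f' t) t)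
    (hf' : ∀ t, 0 ≤ f' t) (h : Tendsto f atBot (𝓝 0)) (t : ℝ) : 0 ≤ f t :=
  (monotone_of_hasDerivAt_nonneg hf hf').le_of_tendsto h t

/-- If `h (‖·‖²)` has nonnegative bilaplacian, its mean over the circle of squared radius
`B² s` lies above its tangent line at `s = 1`. -/
theorem circleMean_tangent_le {h h₁ h₂ h₃ h₄ : ℝ → ℝ}
    (d₀ : ∀ x, 0 ≤ x → HasDerivAt h (h₁ x) x) (d₁ : ∀ x, 0 ≤ x → HasDerivAt h₁ (h₂ x) x)
    (d₂ : ∀ x, 0 ≤ x → HasDerivAt h₂ (h₃ x) x) (d₃ : ∀ x, 0 ≤ x → HasDerivAt h₃ (h₄ x) x)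
    (c₄ : ContinuousOn h₄ (Set.Ici 0))
    (hpos : ∀ x, 0 ≤ x → 0 ≤ 2 * h₂ x + 4 * x * h₃ x + x ^ 2 * h₄ x) (A B t : ℝ) :
    circleMean h A B 0 + circleMeanDeriv h₁ A B 0 * (Real.exp t - 1) ≤ circleMean h A B t := by
  have cont {f f' : ℝ → ℝ} (hf : ∀ x, 0 ≤ x → HasDerivAt f (f' x) x) :
      ContinuousOn f (Set.Ici 0) := fun x hx => (hf x hx).continuousAt.continuousWithinAt
  set k : ℝ → ℝ := fun x => x * h₂ x + h₁ x with hk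
  set k₁ : ℝ → ℝ := fun x => 2 * h₂ x + x * h₃ x with hk₁
  set k₂ : ℝ → ℝ := fun x => 3 * h₃ x + x * h₄ x with hk₂
  have e₀ : ∀ x, 0 ≤ x → HasDerivAt k (k₁ x) x := fun x hx => by
    refine (((hasDerivAt_id x).mul (d₂ x hx)).add (d₁ x hx)).congr_deriv ?_
    simp only [hk₁, id]; ring
  have e₁ : ∀ x, 0 ≤ x → HasDerivAt k₁ (k₂ x) x := fun x hx => by
    refine (((d₂ x hx).const_mul 2).add ((hasDerivAt_id x).mul (d₃ x hx))).congr_deriv ?_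
    simp only [hk₂, id]; ring
  have ck₂ : ContinuousOn k₂ (Set.Ici 0) := by
    have := cont d₃
    fun_prop
  have K₁_nonneg : ∀ t, 0 ≤ circleMeanDeriv k₁ A B t :=
    nonneg_of_deriv_nonneg_of_tendsto_atBot (hasDerivAt_circleMeanDeriv e₁ ck₂ A B)
      (fun t => mul_nonneg (by positivity) (intervalIntegral.integral_nonneg zero_le_one
        fun θ _ => by
          have := hpos _ (sqDist_nonneg A B (Real.exp (t / 2)) θ)
          simp only [hk₁, hk₂]; linarith))
      (tendsto_circleMeanDeriv_atBot (cont e₁) A B)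
  have D_nonneg : ∀ t, 0 ≤ B ^ 2 * Real.exp t * circleMean k A B t - circleMeanDeriv h₁ A B t := by
    refine nonneg_of_deriv_nonneg_of_tendsto_atBot
      (f' := fun t => B ^ 2 * Real.exp t * circleMeanDeriv k₁ A B t) (fun t => ?_)
      (fun t => mul_nonneg (by positivity) (K₁_nonneg t)) ?_
    · refine ((((Real.hasDerivAt_exp t).const_mul (B ^ 2)).mul
        (hasDerivAt_circleMean e₀ (cont e₁) A B t)).sub
        (hasDerivAt_circleMeanDeriv d₁ (cont d₂) A B t)).congr_deriv ?_
      ring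
    · simpa using (tendsto_exp_mul_circleMean_atBot (cont e₀) A B).sub
        (tendsto_circleMeanDeriv_atBot (cont d₁) A B)
  have slope_mono : Monotone fun t => Real.exp (-t) * circleMeanDeriv h₁ A B t := by
    refine monotone_of_hasDerivAt_nonneg (f' := fun t => Real.exp (-t) *
      (B ^ 2 * Real.exp t * circleMean k A B t - circleMeanDeriv h₁ A B t)) (fun t => ?_)
      (fun t => mul_nonneg (Real.exp_pos _).le (D_nonneg t))
    refine (((hasDerivAt_neg t).exp).mul
      (hasDerivAt_circleMeanDeriv d₁ (cont d₂) A B t)).congr_deriv ?_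
    ring
  have hR : ∀ t, HasDerivAt (fun t => circleMean h A B t - circleMeanDeriv h₁ A B 0 * Real.exp t)
      (circleMeanDeriv h₁ A B t - circleMeanDeriv h₁ A B 0 * Real.exp t) t := fun t =>
    (hasDerivAt_circleMean d₀ (cont d₁) A B t).sub ((Real.hasDerivAt_exp t).const_mul _)
  have hfac : ∀ t, circleMeanDeriv h₁ A B t - circleMeanDeriv h₁ A B 0 * Real.exp t
      = Real.exp t * (Real.exp (-t) * circleMeanDeriv h₁ A B t
        - Real.exp (-0) * circleMeanDeriv h₁ A B 0) := fun t => by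
    rw [mul_sub, ← mul_assoc, ← Real.exp_add]
    simp
    ring
  have hRc : Continuous fun t => circleMean h A B t - circleMeanDeriv h₁ A B 0 * Real.exp t :=
    continuous_iff_continuousAt.2 fun t => (hR t).continuousAt
  suffices H : circleMean h A B 0 - circleMeanDeriv h₁ A B 0 * Real.exp 0 ≤
      circleMean h A B t - circleMeanDeriv h₁ A B 0 * Real.exp t by
    rw [Real.exp_zero] at H
    linarith
  rcases le_total 0 t with ht | ht
  · refine monotoneOn_of_hasDerivWithinAt_nonneg (convex_Ici 0) hRc.continuousOn
      (fun x _ => (hR x).hasDerivWithinAt) (fun x hx => ?_) Set.self_mem_Ici ht ht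
    rw [interior_Ici] at hx
    rw [hfac]
    exact mul_nonneg (Real.exp_pos _).le (sub_nonneg.2 (slope_mono (le_of_lt hx)))
  · refine antitoneOn_of_hasDerivWithinAt_nonpos (convex_Iic 0) hRc.continuousOn
      (fun x _ => (hR x).hasDerivWithinAt) (fun x hx => ?_) ht Set.self_mem_Iic ht
    rw [interior_Iic] at hx
    rw [hfac]
    exact mul_nonpos_of_nonneg_of_nonpos (Real.exp_pos _).le
      (sub_nonpos.2 (slope_mono (le_of_lt hx)))

theorem hasDerivAt_add_rpow {ε x : ℝ} (hε : 0 < ε) (hx : 0 ≤ x) (a q : ℝ) :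
    HasDerivAt (fun x => a * (x + ε) ^ q) (a * q * (x + ε) ^ (q - 1)) x := by
  refine ((((hasDerivAt_id x).add_const ε).rpow_const (p := q)
    (Or.inl (by simp only [id]; positivity))).const_mul a).congr_deriv ?_
  simp only [id]
  ring

theorem circleMean_rpow_tangent_le {ε q : ℝ} (hε : 0 < ε) (hq : 1 < q) (A B : ℝ) :
    ∃ m : ℝ, ∀ t, circleMean (fun x => (x + ε) ^ q) A B 0 + m * (Real.exp t - 1) ≤
      circleMean (fun x => (x + ε) ^ q) A B t := by
  have hcont : ContinuousOn (fun x : ℝ => q * (q - 1) * (q - 1 - 1) * (q - 1 - 1 - 1) *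
      (x + ε) ^ (q - 1 - 1 - 1 - 1)) (Set.Ici 0) := fun x hx =>
    (hasDerivAt_add_rpow hε hx _ _).continuousAt.continuousWithinAt
  refine ⟨_, circleMean_tangent_le (fun x hx => by simpa using hasDerivAt_add_rpow hε hx 1 q)
    (fun x hx => hasDerivAt_add_rpow hε hx _ _) (fun x hx => hasDerivAt_add_rpow hε hx _ _)
    (fun x hx => hasDerivAt_add_rpow hε hx _ _) hcont (fun x hx => ?_) A B⟩
  have hY : 0 < x + ε := by positivity
  have e₃ : (x + ε) ^ (q - 1 - 1 - 1) = (x + ε) ^ (q - 1 - 1 - 1 - 1) * (x + ε) := by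
    rw [Real.rpow_sub_one hY.ne' (q - 1 - 1 - 1), div_mul_cancel₀ _ hY.ne']
  have e₂ : (x + ε) ^ (q - 1 - 1) = (x + ε) ^ (q - 1 - 1 - 1 - 1) * (x + ε) ^ 2 := by
    rw [pow_two, ← mul_assoc, ← e₃, Real.rpow_sub_one hY.ne' (q - 1 - 1), div_mul_cancel₀ _ hY.ne']
  rw [e₂, e₃]
  have hq' : 0 < q - 1 := by linarith
  have : 0 ≤ (x + ε) ^ (q - 1 - 1 - 1 - 1) * (q * (q - 1)) *
      (q * (q - 1) * x ^ 2 + 4 * (q - 1) * ε * x + 2 * ε ^ 2) := by positivity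
  linarith [this]

theorem exp_two_pi_mul_I_eq (θ : ℝ) : Complex.exp (2 * Real.pi * Complex.I * θ) =
    ⟨Real.cos (2 * Real.pi * θ), Real.sin (2 * Real.pi * θ)⟩ := by
  have h : (2 * Real.pi * Complex.I * θ : ℂ) = ((2 * Real.pi * θ : ℝ) : ℂ) * Complex.I := by
    push_cast; ring
  rw [h]
  apply Complex.ext
  · exact Complex.exp_ofReal_mul_I_re _
  · exact Complex.exp_ofReal_mul_I_im _

theorem norm_exp_two_pi_mul_I (θ : ℝ) : ‖Complex.exp (2 * Real.pi * Complex.I * θ)‖ = 1 := by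
  have h : (2 * Real.pi * Complex.I * θ : ℂ) = ((2 * Real.pi * θ : ℝ) : ℂ) * Complex.I := by
    push_cast; ring
  rw [h, Complex.norm_exp_ofReal_mul_I]

theorem norm_add_mul_exp_sq (w b : ℂ) (θ : ℝ) :
    ‖w + b * Complex.exp (2 * Real.pi * Complex.I * θ)‖ ^ 2 =
      sqDist ‖w‖ ‖b‖ 1 (θ + (b.arg - w.arg) / (2 * Real.pi)) := by
  have hpi := Real.pi_ne_zero
  have harg : 2 * Real.pi * (θ + (b.arg - w.arg) / (2 * Real.pi)) =
      2 * Real.pi * θ + b.arg - w.arg := by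
    field_simp
    ring
  rw [Complex.sq_norm, Complex.normSq_add, ← Complex.sq_norm, ← Complex.sq_norm, norm_mul,
    norm_exp_two_pi_mul_I, sqDist, harg, exp_two_pi_mul_I_eq]
  simp only [Complex.mul_re, Complex.conj_re, Complex.conj_im, Complex.mul_im]
  rw [Real.cos_sub, Real.cos_add, Real.sin_add, ← Complex.norm_mul_cos_arg w,
    ← Complex.norm_mul_sin_arg w, ← Complex.norm_mul_cos_arg b, ← Complex.norm_mul_sin_arg b]
  ring

theorem integral_norm_add_mul_exp (H : ℝ → ℝ) (w b : ℂ) :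
    ∫ θ in (0 : ℝ)..1, H (‖w + b * Complex.exp (2 * Real.pi * Complex.I * θ)‖ ^ 2) =
      ∫ θ in (0 : ℝ)..1, H (sqDist ‖w‖ ‖b‖ 1 θ) := by
  simp only [norm_add_mul_exp_sq]
  rw [intervalIntegral.integral_comp_add_right (fun θ => H (sqDist ‖w‖ ‖b‖ 1 θ))]
  have hper : Function.Periodic (fun θ => H (sqDist ‖w‖ ‖b‖ 1 θ)) 1 := fun θ => by
    simp only [sqDist, mul_add, mul_one, Real.cos_add_two_pi]
  simpa [add_comm] using hper.intervalIntegral_add_eq ((b.arg - w.arg) / (2 * Real.pi)) 0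

theorem integral_norm_add_mul_exp_eq_circleMean (H : ℝ → ℝ) (w c x : ℂ) (t : ℝ)
    (hx : Real.exp (t / 2) = ‖x‖) :
    ∫ θ in (0 : ℝ)..1, H (‖w + c * x * Complex.exp (2 * Real.pi * Complex.I * θ)‖ ^ 2) =
      circleMean H ‖w‖ ‖c‖ t := by
  rw [integral_norm_add_mul_exp, circleMean, hx]
  simp only [sqDist, norm_mul]
  refine intervalIntegral.integral_congr fun θ _ => ?_
  ring_nf

/-- The standard complex Gaussian distribution, normalized to have `E |g|² = 1`. -/
noncomputable def complexGaussian : Measure ℂ :=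
  volume.withDensity fun x => ENNReal.ofReal (Real.exp (-‖x‖ ^ 2) / Real.pi)

theorem measurable_complexGaussian_density :
    Measurable fun x : ℂ => ENNReal.ofReal (Real.exp (-‖x‖ ^ 2) / Real.pi) := by fun_prop

theorem lintegral_complexGaussian_norm_rpow {q : ℝ} (hq : 0 ≤ q) :
    ∫⁻ x, ENNReal.ofReal (‖x‖ ^ q) ∂complexGaussian = ENNReal.ofReal (Real.Gamma (1 + q / 2)) := by
  have hval : ∫ x : ℂ, ‖x‖ ^ q * Real.exp (-‖x‖ ^ 2) = Real.pi * Real.Gamma (1 + q / 2) := by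
    have h := Complex.integral_rpow_mul_exp_neg_rpow (p := 2) (q := q) one_le_two (by linarith)
    simp only [Real.rpow_two] at h
    rw [h, show (q + 2) / 2 = 1 + q / 2 by ring]
    ring
  have hpos : 0 < Real.pi * Real.Gamma (1 + q / 2) :=
    mul_pos Real.pi_pos (Real.Gamma_pos_of_pos (by positivity))
  have hint : Integrable fun x : ℂ => ‖x‖ ^ q * Real.exp (-‖x‖ ^ 2) :=
    Integrable.of_integral_ne_zero (by rw [hval]; exact hpos.ne')
  rw [complexGaussian, lintegral_withDensity_eq_lintegral_mul _ measurable_complexGaussian_density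
    (by fun_prop)]
  have hmul : ∀ x : ℂ, ((fun x : ℂ => ENNReal.ofReal (Real.exp (-‖x‖ ^ 2) / Real.pi)) *
      fun x : ℂ => ENNReal.ofReal (‖x‖ ^ q)) x =
      ENNReal.ofReal (‖x‖ ^ q * Real.exp (-‖x‖ ^ 2) / Real.pi) := fun x => by
    rw [Pi.mul_apply, ← ENNReal.ofReal_mul (by positivity)]
    congr 1
    ring
  simp only [hmul]
  rw [← ofReal_integral_eq_lintegral_ofReal (hint.div_const _)
    (Eventually.of_forall fun x => by positivity), integral_div, hval,
    mul_div_cancel_left₀ _ Real.pi_ne_zero]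

instance : IsProbabilityMeasure complexGaussian :=
  ⟨by simpa using lintegral_complexGaussian_norm_rpow le_rfl⟩

theorem integrable_complexGaussian_norm_sq :
    Integrable (fun x : ℂ => ‖x‖ ^ 2) complexGaussian := by
  refine ⟨by fun_prop, ?_⟩
  rw [hasFiniteIntegral_iff_ofReal (Eventually.of_forall fun x => by positivity)]
  have h := lintegral_complexGaussian_norm_rpow (q := 2) zero_le_two
  simp only [Real.rpow_two] at h
  rw [h]
  exact ENNReal.ofReal_lt_top

theorem integral_complexGaussian_norm_sq : ∫ x, ‖x‖ ^ 2 ∂complexGaussian = 1 := by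
  have h := lintegral_complexGaussian_norm_rpow (q := 2) zero_le_two
  simp only [Real.rpow_two] at h
  rw [integral_eq_lintegral_of_nonneg_ae (Eventually.of_forall fun x => by positivity)
    (by fun_prop), h, show (1 + 2 / 2 : ℝ) = 2 by norm_num, Real.Gamma_two]
  simp

theorem charFun_complexGaussian (t : ℂ) :
    charFun complexGaussian t = Complex.exp (-(‖t‖ ^ 2 / 4 : ℝ)) := by
  rw [charFun_apply, complexGaussian, integral_withDensity_eq_integral_toReal_smul
    measurable_complexGaussian_density (Eventually.of_forall fun _ => ENNReal.ofReal_lt_top)]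
  have h := GaussianFourier.integral_cexp_neg_mul_sq_norm_add (b := 1) (by simp) Complex.I t
  have hfun : ∀ x : ℂ, (ENNReal.ofReal (Real.exp (-‖x‖ ^ 2) / Real.pi)).toReal •
      Complex.exp ((inner ℝ x t : ℝ) * Complex.I) = (Real.pi : ℂ)⁻¹ *
        Complex.exp (-1 * (‖x‖ : ℂ) ^ 2 + Complex.I * (inner ℝ t x : ℝ)) := fun x => by
    rw [ENNReal.toReal_ofReal (by positivity), Complex.exp_add, real_inner_comm, Complex.real_smul,
      mul_comm Complex.I]
    push_cast
    ring_nf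
  simp only [hfun]
  rw [integral_const_mul, h, Complex.finrank_real_complex]
  have hpi : (Real.pi : ℂ) ≠ 0 := by exact_mod_cast Real.pi_ne_zero
  simp only [Nat.cast_ofNat, div_one, ne_eq, OfNat.ofNat_ne_zero, not_false_eq_true, div_self,
    Complex.cpow_one, Complex.I_sq]
  rw [← mul_assoc, inv_mul_cancel₀ hpi, one_mul]
  congr 1
  push_cast
  ring

theorem charFun_map_mul_complexGaussian (c t : ℂ) :
    charFun (complexGaussian.map (c * ·)) t = Complex.exp (-(‖c‖ ^ 2 * ‖t‖ ^ 2 / 4 : ℝ)) := by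
  rw [charFun_apply, integral_map (by fun_prop) (by fun_prop)]
  have hinner : ∀ x : ℂ, inner ℝ (c * x) t = inner ℝ x ((starRingEnd ℂ) c * t) := fun x => by
    simp only [Complex.inner, map_mul]
    congr 1
    ring
  simp only [hinner]
  rw [← charFun_apply, charFun_complexGaussian, norm_mul, Complex.norm_conj, mul_pow]

instance (c : ℂ) : IsProbabilityMeasure (complexGaussian.map (c * ·)) :=
  Measure.isProbabilityMeasure_map (by fun_prop)

theorem map_mul_complexGaussian_eq {a b : ℂ} (h : ‖a‖ = ‖b‖) :
    complexGaussian.map (a * ·) = complexGaussian.map (b * ·) :=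
  Measure.ext_of_charFun (funext fun t => by simp only [charFun_map_mul_complexGaussian, h])

theorem map_mul_complexGaussian_conv {a b c : ℂ} (h : ‖a‖ ^ 2 + ‖b‖ ^ 2 = ‖c‖ ^ 2) :
    (complexGaussian.map (a * ·)) ∗ (complexGaussian.map (b * ·)) =
      complexGaussian.map (c * ·) :=
  Measure.ext_of_charFun (funext fun t => by
    rw [charFun_conv]
    simp only [charFun_map_mul_complexGaussian]
    rw [← Complex.exp_add, ← h]
    congr 1
    push_cast
    ring)

theorem lintegral_mul_complexGaussian_eq {f : ℂ → ENNReal} (hf : Measurable f) {a b : ℂ}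
    (h : ‖a‖ = ‖b‖) :
    ∫⁻ x, f (a * x) ∂complexGaussian = ∫⁻ x, f (b * x) ∂complexGaussian := by
  rw [← lintegral_map hf (by fun_prop), map_mul_complexGaussian_eq h,
    lintegral_map hf (by fun_prop)]

theorem lintegral_add_mul_complexGaussian {f : ℂ → ENNReal} (hf : Measurable f) {a b c : ℂ}
    (h : ‖a‖ ^ 2 + ‖b‖ ^ 2 = ‖c‖ ^ 2) :
    ∫⁻ x, ∫⁻ y, f (a * x + b * y) ∂complexGaussian ∂complexGaussian =
      ∫⁻ x, f (c * x) ∂complexGaussian := by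
  rw [← lintegral_map hf (by fun_prop : Measurable (c * ·)), ← map_mul_complexGaussian_conv h,
    Measure.lintegral_conv hf, lintegral_map (Measurable.lintegral_prod_right'
      (f := fun p : ℂ × ℂ => f (p.1 + p.2)) (by fun_prop)) (by fun_prop)]
  refine lintegral_congr fun x => ?_
  rw [lintegral_map (by fun_prop) (by fun_prop)]

theorem ofReal_integral_le_lintegral_ofReal {α : Type*} [MeasurableSpace α] {μ : Measure α}
    {f : α → ℝ} (hf : Integrable f μ) :
    ENNReal.ofReal (∫ x, f x ∂μ) ≤ ∫⁻ x, ENNReal.ofReal (f x) ∂μ := by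
  rw [integral_eq_lintegral_pos_part_sub_lintegral_neg_part hf]
  refine (ENNReal.ofReal_le_ofReal (sub_le_self _ ENNReal.toReal_nonneg)).trans ?_
  exact ENNReal.ofReal_toReal_le

theorem continuous_norm_sq_add_rpow {ε : ℝ} (hε : 0 < ε) (q : ℝ) :
    Continuous fun x : ℂ => (‖x‖ ^ 2 + ε) ^ q :=
  Continuous.rpow_const (by fun_prop) fun x => Or.inl (by positivity)

theorem lintegral_norm_add_mul_exp_eq_ofReal {ε : ℝ} (hε : 0 < ε) (q : ℝ) (w b : ℂ) :
    ∫⁻ θ in Set.Ioc (0 : ℝ) 1, ENNReal.ofReal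
        ((‖w + b * Complex.exp (2 * Real.pi * Complex.I * θ)‖ ^ 2 + ε) ^ q) =
      ENNReal.ofReal (∫ θ in (0 : ℝ)..1,
        (‖w + b * Complex.exp (2 * Real.pi * Complex.I * θ)‖ ^ 2 + ε) ^ q) := by
  have hcb : Continuous fun θ : ℝ =>
      (‖w + b * Complex.exp (2 * Real.pi * Complex.I * θ)‖ ^ 2 + ε) ^ q :=
    (continuous_norm_sq_add_rpow hε q).comp (by fun_prop :
      Continuous fun θ : ℝ => w + b * Complex.exp (2 * Real.pi * Complex.I * θ))
  rw [intervalIntegral.integral_of_le zero_le_one, ofReal_integral_eq_lintegral_ofReal]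
  · exact (intervalIntegrable_iff_integrableOn_Ioc_of_le zero_le_one).1
      (hcb.intervalIntegrable 0 1)
  · exact Eventually.of_forall fun θ => by positivity

/-- Rotation invariance: averaging over circles does not change a Gaussian integral. -/
theorem lintegral_complexGaussian_eq_lintegral_circle {f : ℂ → ENNReal} (hf : Measurable f)
    (c : ℂ) :
    ∫⁻ x, f (c * x) ∂complexGaussian = ∫⁻ x, (∫⁻ θ in Set.Ioc (0 : ℝ) 1,
      f (c * x * Complex.exp (2 * Real.pi * Complex.I * θ))) ∂complexGaussian := by
  rw [lintegral_lintegral_swap (by fun_prop)]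
  have h : ∀ θ : ℝ, ∫⁻ x, f (c * x * Complex.exp (2 * Real.pi * Complex.I * θ))
      ∂complexGaussian = ∫⁻ x, f (c * x) ∂complexGaussian := fun θ => by
    rw [lintegral_mul_complexGaussian_eq hf (a := c)
      (b := c * Complex.exp (2 * Real.pi * Complex.I * θ))
      (by rw [norm_mul, norm_exp_two_pi_mul_I, mul_one])]
    simp only [mul_right_comm]
  simp [h]

theorem integral_circle_tangent_le {ε q : ℝ} (hε : 0 < ε) (hq : 1 < q) (w c : ℂ) :
    ∃ m : ℝ, ∀ x : ℂ, x ≠ 0 →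
      (∫ θ in (0 : ℝ)..1, (‖w + c * Complex.exp (2 * Real.pi * Complex.I * θ)‖ ^ 2 + ε) ^ q) +
        m * (‖x‖ ^ 2 - 1) ≤
      ∫ θ in (0 : ℝ)..1, (‖w + c * x * Complex.exp (2 * Real.pi * Complex.I * θ)‖ ^ 2 + ε) ^ q := by
  obtain ⟨m, hm⟩ := circleMean_rpow_tangent_le hε hq ‖w‖ ‖c‖
  refine ⟨m, fun x hx => ?_⟩
  have hx' : 0 < ‖x‖ := norm_pos_iff.2 hx
  have h₀ := integral_norm_add_mul_exp_eq_circleMean (fun x => (x + ε) ^ q) w c 1 0 (by simp)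
  have h := integral_norm_add_mul_exp_eq_circleMean (fun x => (x + ε) ^ q) w c x
    (2 * Real.log ‖x‖) (by rw [mul_div_cancel_left₀ _ two_ne_zero, Real.exp_log hx'])
  have he : Real.exp (2 * Real.log ‖x‖) = ‖x‖ ^ 2 := by
    rw [two_mul, Real.exp_add, Real.exp_log hx', pow_two]
  rw [mul_one] at h₀
  rw [h, h₀, ← he]
  exact hm _

theorem ae_ne_zero_complexGaussian : ∀ᵐ x ∂complexGaussian, x ≠ (0 : ℂ) :=
  (withDensity_absolutelyContinuous volume _).ae_le (Measure.ae_ne volume 0)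

theorem ofReal_le_lintegral_of_tangent {L m : ℝ} {g : ℂ → ℝ}
    (h : ∀ x : ℂ, x ≠ 0 → L + m * (‖x‖ ^ 2 - 1) ≤ g x) :
    ENNReal.ofReal L ≤ ∫⁻ x, ENNReal.ofReal (g x) ∂complexGaussian := by
  have hint := integrable_complexGaussian_norm_sq
  have hint' : Integrable (fun x : ℂ => m * (‖x‖ ^ 2 - 1)) complexGaussian :=
    (hint.sub (integrable_const 1)).const_mul m
  have hmean : ∫ x, (L + m * (‖x‖ ^ 2 - 1)) ∂complexGaussian = L := by
    rw [integral_add (integrable_const L) hint', integral_const_mul,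
      integral_sub hint (integrable_const (1 : ℝ)), integral_complexGaussian_norm_sq,
      integral_const, integral_const, probReal_univ, one_smul, one_smul, sub_self, mul_zero,
      add_zero]
  have hle := ofReal_integral_le_lintegral_ofReal ((integrable_const L).add hint')
  simp only [Pi.add_apply, hmean] at hle
  exact hle.trans (lintegral_mono_ae (ae_ne_zero_complexGaussian.mono fun x hx =>
    ENNReal.ofReal_le_ofReal (h x hx)))

/-- Replacing one Steinhaus variable by a complex Gaussian increases the moment. -/
theorem lintegral_steinhaus_le_complexGaussian {ε q : ℝ} (hε : 0 < ε) (hq : 1 < q) (w c : ℂ) :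
    ∫⁻ θ in Set.Ioc (0 : ℝ) 1, ENNReal.ofReal
        ((‖w + c * Complex.exp (2 * Real.pi * Complex.I * θ)‖ ^ 2 + ε) ^ q) ≤
      ∫⁻ x, ENNReal.ofReal ((‖w + c * x‖ ^ 2 + ε) ^ q) ∂complexGaussian := by
  have hm : Measurable fun x : ℂ => ENNReal.ofReal ((‖w + x‖ ^ 2 + ε) ^ q) :=
    ((continuous_norm_sq_add_rpow hε q).comp (continuous_const_add w)).measurable.ennreal_ofReal
  rw [lintegral_complexGaussian_eq_lintegral_circle hm c]
  simp only [lintegral_norm_add_mul_exp_eq_ofReal hε q w]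
  obtain ⟨m, hm⟩ := integral_circle_tangent_le hε hq w c
  exact ofReal_le_lintegral_of_tangent hm

theorem lintegral_steinhaus_sum_le_complexGaussian {ε q : ℝ} (hε : 0 < ε) (hq : 1 < q) (d : ℕ)
    (c : Fin d → ℂ) (w : ℂ) :
    ∫⁻ θ, ENNReal.ofReal
        ((‖w + ∑ j, c j * Complex.exp (2 * Real.pi * Complex.I * θ j)‖ ^ 2 + ε) ^ q)
        ∂(Measure.pi fun _ : Fin d => (volume : Measure ℝ).restrict (Set.Ioc 0 1)) ≤
      ∫⁻ x, ENNReal.ofReal ((‖w + (√(∑ j, ‖c j‖ ^ 2) : ℝ) * x‖ ^ 2 + ε) ^ q)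
        ∂complexGaussian := by
  have hc := continuous_norm_sq_add_rpow hε q
  induction d generalizing w with
  | zero => simp
  | succ d ih =>
    set μ := (volume : Measure ℝ).restrict (Set.Ioc 0 1) with hμ
    set σ : ℝ := √(∑ j : Fin d, ‖c j.succ‖ ^ 2) with hσ
    have hmeas : Measurable fun p : ℝ × (Fin d → ℝ) => ENNReal.ofReal
        ((‖w + c 0 * Complex.exp (2 * Real.pi * Complex.I * p.1) +
          ∑ j, c j.succ * Complex.exp (2 * Real.pi * Complex.I * p.2 j)‖ ^ 2 + ε) ^ q) :=
      (hc.comp (by fun_prop : Continuous fun p : ℝ × (Fin d → ℝ) =>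
        w + c 0 * Complex.exp (2 * Real.pi * Complex.I * p.1) +
          ∑ j, c j.succ * Complex.exp (2 * Real.pi * Complex.I * p.2 j))).measurable.ennreal_ofReal
    have hsplit := (measurePreserving_piFinSuccAbove (fun _ : Fin (d + 1) => μ) 0).lintegral_comp
      hmeas
    simp only [MeasurableEquiv.piFinSuccAbove_apply, Fin.insertNthEquiv_zero,
      Fin.consEquiv_symm_apply, Fin.tail] at hsplit
    simp only [Fin.sum_univ_succ, ← add_assoc]
    rw [hsplit, lintegral_prod _ hmeas.aemeasurable]
    calc _ ≤ ∫⁻ θ, ∫⁻ x, ENNReal.ofReal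
          ((‖w + c 0 * Complex.exp (2 * Real.pi * Complex.I * θ) + (σ : ℂ) * x‖ ^ 2 + ε) ^ q)
          ∂complexGaussian ∂μ := lintegral_mono fun θ => ih _ _
      _ = ∫⁻ x, ∫⁻ θ, ENNReal.ofReal
          ((‖w + (σ : ℂ) * x + c 0 * Complex.exp (2 * Real.pi * Complex.I * θ)‖ ^ 2 + ε) ^ q)
          ∂μ ∂complexGaussian := by
        rw [lintegral_lintegral_swap]
        · simp only [add_right_comm]
        · exact (hc.comp (by fun_prop : Continuous fun p : ℝ × ℂ =>
            w + c 0 * Complex.exp (2 * Real.pi * Complex.I * p.1) +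
              (σ : ℂ) * p.2)).measurable.ennreal_ofReal.aemeasurable
      _ ≤ ∫⁻ x, ∫⁻ y, ENNReal.ofReal ((‖w + (σ : ℂ) * x + c 0 * y‖ ^ 2 + ε) ^ q)
          ∂complexGaussian ∂complexGaussian :=
        lintegral_mono fun x => lintegral_steinhaus_le_complexGaussian hε hq _ _
      _ = _ := by
        simp only [add_assoc]
        refine lintegral_add_mul_complexGaussian
          (f := fun x => ENNReal.ofReal ((‖w + x‖ ^ 2 + ε) ^ q))
          (hc.comp (continuous_const_add w)).measurable.ennreal_ofReal ?_
        rw [Complex.norm_real, Complex.norm_real, Real.norm_of_nonneg (Real.sqrt_nonneg _),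
          Real.norm_of_nonneg (Real.sqrt_nonneg _), Real.sq_sqrt (by positivity),
          Real.sq_sqrt (by positivity), add_comm]

theorem lintegral_steinhaus_sum_rpow_le {p : ℝ} (hp : 2 < p) (d : ℕ) (c : Fin d → ℂ) :
    ∫⁻ θ, ENNReal.ofReal (‖∑ j, c j * Complex.exp (2 * Real.pi * Complex.I * θ j)‖ ^ p)
        ∂(Measure.pi fun _ : Fin d => (volume : Measure ℝ).restrict (Set.Ioc 0 1)) ≤
      ENNReal.ofReal (Real.Gamma (1 + p / 2) * √(∑ j, ‖c j‖ ^ 2) ^ p) := by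
  set σ := √(∑ j, ‖c j‖ ^ 2) with hσ
  have hσ0 : 0 ≤ σ := Real.sqrt_nonneg _
  have hq : 1 < p / 2 := by linarith
  have hsq : ∀ r : ℝ, 0 ≤ r → (r ^ 2) ^ (p / 2) = r ^ p := fun r hr => by
    rw [← Real.rpow_natCast_mul hr]
    congr 1
    push_cast
    ring
  have hval : ∫⁻ x : ℂ, ENNReal.ofReal (((σ * ‖x‖) ^ 2) ^ (p / 2)) ∂complexGaussian =
      ENNReal.ofReal (Real.Gamma (1 + p / 2) * σ ^ p) := by
    have h : ∀ x : ℂ, ENNReal.ofReal (((σ * ‖x‖) ^ 2) ^ (p / 2)) =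
        ENNReal.ofReal (σ ^ p) * ENNReal.ofReal (‖x‖ ^ p) := fun x => by
      rw [hsq _ (by positivity), Real.mul_rpow hσ0 (norm_nonneg _),
        ENNReal.ofReal_mul (by positivity)]
    simp only [h]
    rw [lintegral_const_mul _ (by fun_prop), lintegral_complexGaussian_norm_rpow (by linarith),
      ← ENNReal.ofReal_mul (by positivity), mul_comm]
  have hlim : Tendsto (fun ε : ℝ => ∫⁻ x : ℂ, ENNReal.ofReal (((σ * ‖x‖) ^ 2 + ε) ^ (p / 2))
      ∂complexGaussian) (𝓝[>] 0) (𝓝 (ENNReal.ofReal (Real.Gamma (1 + p / 2) * σ ^ p))) := by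
    rw [← hval]
    refine tendsto_lintegral_filter_of_dominated_convergence
      (fun x => ENNReal.ofReal (2 ^ (p / 2 - 1)) *
        (ENNReal.ofReal (((σ * ‖x‖) ^ 2) ^ (p / 2)) + 1)) ?_ ?_ ?_ ?_
    · exact Eventually.of_forall fun ε => by fun_prop
    · filter_upwards [Ioc_mem_nhdsGT (zero_lt_one' ℝ)] with ε hε
      refine Eventually.of_forall fun x => ?_
      have hle : ((σ * ‖x‖) ^ 2 + ε) ^ (p / 2) ≤
          2 ^ (p / 2 - 1) * (((σ * ‖x‖) ^ 2) ^ (p / 2) + 1) := by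
        have h := NNReal.coe_le_coe.2 (NNReal.rpow_add_le_mul_rpow_add_rpow
          ((σ * ‖x‖) ^ 2).toNNReal 1 hq.le)
        push_cast [Real.coe_toNNReal _ (sq_nonneg (σ * ‖x‖))] at h
        rw [Real.one_rpow] at h
        refine le_trans (Real.rpow_le_rpow ?_ ?_ (by linarith)) h
        · have := hε.1
          positivity
        · linarith [hε.2]
      refine (ENNReal.ofReal_le_ofReal hle).trans ?_
      rw [ENNReal.ofReal_mul (by positivity), ENNReal.ofReal_add (by positivity) zero_le_one,
        ENNReal.ofReal_one]
    · rw [lintegral_const_mul _ (by fun_prop), lintegral_add_right _ measurable_const, hval]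
      simp [ENNReal.mul_eq_top]
    · refine Eventually.of_forall fun x => ENNReal.tendsto_ofReal ?_
      have hcont : Continuous fun ε : ℝ => ((σ * ‖x‖) ^ 2 + ε) ^ (p / 2) :=
        Continuous.rpow_const (by fun_prop) fun _ => Or.inr (by linarith)
      simpa using (hcont.tendsto 0).mono_left nhdsWithin_le_nhds
  refine ge_of_tendsto hlim ?_
  filter_upwards [self_mem_nhdsWithin] with ε hε
  have hmain := lintegral_steinhaus_sum_le_complexGaussian hε hq d c 0
  simp only [zero_add, norm_mul, Complex.norm_real, Real.norm_of_nonneg hσ0, ← hσ] at hmain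
  refine (lintegral_mono fun θ => ENNReal.ofReal_le_ofReal ?_).trans hmain
  rw [← hsq _ (norm_nonneg _)]
  exact Real.rpow_le_rpow (by positivity) (le_add_of_nonneg_right (le_of_lt hε)) (by linarith)

theorem stmt_16 (p : ℝ) (hp : 2 < p) (d : ℕ) (c : Fin d → ℂ) :
    (∫ θ in Set.univ.pi fun _ : Fin d => Set.Ioc (0:ℝ) 1,
        ‖∑ j, c j * Complex.exp (2 * Real.pi * Complex.I * θ j)‖ ^ p) ^ (1 / p)
      ≤ Real.Gamma (1 + p / 2) ^ (1 / p) * (∑ j, ‖c j‖ ^ 2) ^ (1 / 2 : ℝ) := by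
  have hp0 : 0 < p := by linarith
  have hΓ : 0 < Real.Gamma (1 + p / 2) := Real.Gamma_pos_of_pos (by positivity)
  have hint : ∫ θ in Set.univ.pi fun _ : Fin d => Set.Ioc (0 : ℝ) 1,
      ‖∑ j, c j * Complex.exp (2 * Real.pi * Complex.I * θ j)‖ ^ p ≤
      Real.Gamma (1 + p / 2) * √(∑ j, ‖c j‖ ^ 2) ^ p := by
    rw [volume_pi, Measure.restrict_pi_pi, integral_eq_lintegral_of_nonneg_ae
      (Eventually.of_forall fun θ => by positivity)]
    · exact ENNReal.toReal_le_of_le_ofReal (by positivity)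
        (lintegral_steinhaus_sum_rpow_le hp d c)
    · refine Continuous.aestronglyMeasurable ?_
      exact Continuous.rpow_const (by fun_prop) fun _ => Or.inr hp0.le
  refine (Real.rpow_le_rpow (integral_nonneg fun θ => by positivity) hint (by positivity)).trans ?_
  rw [Real.mul_rpow hΓ.le (by positivity), ← Real.rpow_mul (Real.sqrt_nonneg _),
    mul_one_div_cancel hp0.ne', Real.rpow_one, Real.sqrt_eq_rpow]
end

section
/- If φ is a nontrivial function in the Hardy space H¹(T^d), then log|φ| is integrable on T^d; in particular the zero set {z ∈ T^d : φ(z) = 0} has Haar measure zero. -/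
open MeasureTheory

/-- The `d`-torus parametrized as the box `(0,1]^d` in `ℝ^d`. -/
def torusBox (d : ℕ) : Set (Fin d → ℝ) := Set.univ.pi fun _ => Set.Ioc (0:ℝ) 1

open Filter Topology

section Approximation

variable {X : Type*} [TopologicalSpace X] [NormalSpace X] [MeasurableSpace X] [BorelSpace X]
  {μ : Measure X} [IsFiniteMeasure μ] [μ.WeaklyRegular]

/-- A bounded measurable function is the almost everywhere limit of continuous functions satisfying
the same bound. -/
theorem exists_seq_continuousMap_tendsto_ae {ψ : X → ℝ} (hψ : AEStronglyMeasurable ψ μ) {C : ℝ}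
    (hC : ∀ x, |ψ x| ≤ C) :
    ∃ g : ℕ → C(X, ℝ), (∀ n x, |g n x| ≤ C) ∧
      ∀ᵐ x ∂μ, Tendsto (fun n => g n x) atTop (𝓝 (ψ x)) := by
  have hint : MemLp ψ 1 μ := MemLp.of_bound hψ C (Eventually.of_forall hC)
  have hex (n : ℕ) := hint.exists_boundedContinuous_eLpNorm_sub_le (μ := μ) ENNReal.one_ne_top
    (ε := ((n : ENNReal) + 1)⁻¹) (by simp)
  choose g hg hgL using hex
  have hlim : Tendsto (fun n => eLpNorm (⇑(g n) - ψ) 1 μ) atTop (𝓝 0) := by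
    have h0 : Tendsto (fun n : ℕ => ((n : ENNReal) + 1)⁻¹) atTop (𝓝 0) := by
      have := (tendsto_add_atTop_iff_nat 1).2 ENNReal.tendsto_inv_nat_nhds_zero
      simpa using this
    refine tendsto_of_tendsto_of_tendsto_of_le_of_le tendsto_const_nhds h0 (fun _ => zero_le) ?_
    intro n
    simpa only [← neg_sub ψ, eLpNorm_neg] using hg n
  obtain ⟨k, -, hk⟩ := (tendstoInMeasure_of_tendsto_eLpNorm one_ne_zero
    (fun n => (hgL n).1) hψ hlim).exists_seq_tendsto_ae
  refine ⟨fun n => ⟨fun x => max (-C) (min (g (k n) x) C), by fun_prop⟩, fun n x => ?_, ?_⟩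
  · have : 0 ≤ C := (abs_nonneg _).trans (hC x)
    exact abs_le.2 ⟨le_max_left _ _, max_le (by linarith) (min_le_right _ _)⟩
  · filter_upwards [hk] with x hx
    have h1 := tendsto_const_nhds (x := -C).max (hx.min (tendsto_const_nhds (x := C)))
    obtain ⟨h2, h3⟩ := abs_le.1 (hC x)
    rwa [min_eq_left h3, max_eq_right h2] at h1

/-- An integrable function that integrates to zero against every continuous function vanishes
almost everywhere. -/
theorem ae_eq_zero_of_forall_integral_continuousMap_mul_eq_zero {f : X → ℂ} (hf : Integrable f μ)
    (h : ∀ g : C(X, ℝ), ∫ x, (g x : ℂ) * f x ∂μ = 0) : f =ᵐ[μ] 0 := by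
  refine hf.ae_eq_zero_of_forall_setIntegral_eq_zero fun s hs _ => ?_
  obtain ⟨g, hgb, hg⟩ := exists_seq_continuousMap_tendsto_ae (μ := μ)
    (ψ := s.indicator 1) (C := 1)
    ((measurable_one.indicator hs).aestronglyMeasurable) (fun x => by
      by_cases hx : x ∈ s <;> simp [hx])
  have hlim : Tendsto (fun n => ∫ x, (g n x : ℂ) * f x ∂μ) atTop
      (𝓝 (∫ x, ((s.indicator 1 x : ℝ) : ℂ) * f x ∂μ)) := by
    refine tendsto_integral_of_dominated_convergence (fun x => ‖f x‖) (fun n => ?_) hf.norm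
      (fun n => Eventually.of_forall fun x => ?_) ?_
    · exact (Complex.continuous_ofReal.comp (g n).continuous).measurable.aestronglyMeasurable.mul
        hf.1
    · rw [norm_mul, Complex.norm_real, Real.norm_eq_abs]
      exact mul_le_of_le_one_left (norm_nonneg _) (hgb n x)
    · filter_upwards [hg] with x hx
      exact ((Complex.continuous_ofReal.tendsto _).comp hx).mul_const _
  simp only [h] at hlim
  rw [← integral_indicator hs, tendsto_nhds_unique tendsto_const_nhds hlim]
  refine integral_congr_ae (Eventually.of_forall fun x => ?_)
  by_cases hx : x ∈ s <;> simp [hx]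

end Approximation

section GeometricMean

variable {X : Type*} [MeasurableSpace X] {μ : Measure X}

/-- The inequality `c * exp (∫ ψ) ≤ ∫ w * exp ψ` passes to bounded almost everywhere limits
in `ψ`. -/
theorem mul_exp_integral_le_of_tendsto [IsFiniteMeasure μ] {w : X → ℝ} (hw : Integrable w μ)
    {c C : ℝ} {ψ : X → ℝ} {g : ℕ → X → ℝ} (hg : ∀ n, AEStronglyMeasurable (g n) μ)
    (hC : ∀ n x, |g n x| ≤ C) (hlim : ∀ᵐ x ∂μ, Tendsto (fun n => g n x) atTop (𝓝 (ψ x)))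
    (h : ∀ n, c * Real.exp (∫ x, g n x ∂μ) ≤ ∫ x, w x * Real.exp (g n x) ∂μ) :
    c * Real.exp (∫ x, ψ x ∂μ) ≤ ∫ x, w x * Real.exp (ψ x) ∂μ := by
  refine le_of_tendsto_of_tendsto' (b := atTop) (Tendsto.const_mul c ?_) ?_ h
  · refine (Real.continuous_exp.tendsto _).comp ?_
    exact tendsto_integral_of_dominated_convergence (fun _ => C) hg (integrable_const _)
      (fun n => Eventually.of_forall (hC n)) hlim
  · refine tendsto_integral_of_dominated_convergence (fun x => ‖w x‖ * Real.exp C) (fun n => ?_)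
      (hw.norm.mul_const _) (fun n => Eventually.of_forall fun x => ?_) ?_
    · exact hw.1.mul (Real.continuous_exp.comp_aestronglyMeasurable (hg n))
    · rw [norm_mul, Real.norm_eq_abs (Real.exp _), Real.abs_exp]
      gcongr
      exact (le_abs_self _).trans (hC n x)
    · filter_upwards [hlim] with x hx
      exact ((Real.continuous_exp.tendsto _).comp hx).const_mul _

/-- A nonnegative integrable weight whose geometric mean is positive, in the dual sense that
`c * exp (∫ ψ) ≤ ∫ w * exp ψ` for all bounded `ψ`, is almost everywhere positive and has integrable
logarithm. -/
theorem integrable_log_of_mul_exp_integral_le [IsProbabilityMeasure μ] {w : X → ℝ}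
    (hw : Integrable w μ) (hw0 : ∀ x, 0 ≤ w x) {c : ℝ} (hc : 0 < c)
    (h : ∀ (ψ : X → ℝ) (C : ℝ), AEStronglyMeasurable ψ μ → (∀ x, |ψ x| ≤ C) →
      c * Real.exp (∫ x, ψ x ∂μ) ≤ ∫ x, w x * Real.exp (ψ x) ∂μ) :
    Integrable (fun x => Real.log (w x)) μ ∧ μ {x | w x = 0} = 0 := by
  set v : ℕ → X → ℝ := fun N x => max (Real.exp (-N)) (min (w x) 1) with hv
  set ψ : ℕ → X → ℝ := fun N x => -Real.log (v N x) with hψdef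
  have hvpos (N x) : 0 < v N x := lt_max_of_lt_left (Real.exp_pos _)
  have hv1 (N x) : v N x ≤ 1 :=
    max_le (Real.exp_le_one_iff.2 (by simp)) (min_le_right _ _)
  have hψ0 (N x) : 0 ≤ ψ N x :=
    neg_nonneg.2 (Real.log_nonpos (hvpos N x).le (hv1 N x))
  have hψN (N : ℕ) (x) : ψ N x ≤ N := by
    have := Real.log_le_log (Real.exp_pos _) (le_max_left (Real.exp (-N)) (min (w x) 1))
    rw [Real.log_exp] at this
    simp only [hψdef, hv]
    linarith
  have hψm (N) : AEStronglyMeasurable (ψ N) μ := by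
    have h1 : AEMeasurable w μ := hw.1.aemeasurable
    exact (((aemeasurable_const.max (h1.min aemeasurable_const)).log).neg).aestronglyMeasurable
  have hψi (N) : Integrable (ψ N) μ :=
    Integrable.of_bound (hψm N) N (Eventually.of_forall fun x => by
      rw [Real.norm_eq_abs, abs_of_nonneg (hψ0 N x)]; exact hψN N x)
  set K : ℝ := ∫ x, (1 + w x) ∂μ with hK
  have hbound (N) : ∫ x, ψ N x ∂μ ≤ Real.log (K / c) := by
    have h1 := h (ψ N) N (hψm N) fun x => by
      rw [abs_of_nonneg (hψ0 N x)]; exact hψN N x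
    have h2 : ∫ x, w x * Real.exp (ψ N x) ∂μ ≤ K := by
      refine integral_mono_of_nonneg (Eventually.of_forall fun x =>
        mul_nonneg (hw0 x) (Real.exp_pos _).le) ((integrable_const _).add hw)
        (Eventually.of_forall fun x => ?_)
      simp only [hψdef]
      rw [Real.exp_neg, Real.exp_log (hvpos N x), ← div_eq_mul_inv, div_le_iff₀ (hvpos N x)]
      have h3 : min (w x) 1 ≤ v N x := le_max_right _ _
      have h4 := hw0 x
      rcases min_choice (w x) 1 with h5 | h5 <;> rw [h5] at h3 <;> nlinarith
    have h6 : Real.exp (∫ x, ψ N x ∂μ) ≤ K / c := by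
      rw [le_div_iff₀ hc]; linarith
    rw [← Real.log_exp (∫ x, ψ N x ∂μ)]
    exact Real.log_le_log (Real.exp_pos _) h6
  have hlint (N) : ∫⁻ x, ENNReal.ofReal (ψ N x) ∂μ ≤ ENNReal.ofReal (Real.log (K / c)) := by
    rw [← ofReal_integral_eq_lintegral_ofReal (hψi N) (Eventually.of_forall (hψ0 N))]
    exact ENNReal.ofReal_le_ofReal (hbound N)
  have hzero : μ {x | w x = 0} = 0 := by
    by_contra hne
    have h1 (N : ℕ) : (N : ENNReal) * μ {x | w x = 0} ≤ ENNReal.ofReal (Real.log (K / c)) := by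
      refine le_trans ?_ (hlint N)
      refine le_trans ?_ (mul_meas_ge_le_lintegral₀ (hψm N).aemeasurable.ennreal_ofReal N)
      gcongr
      intro hx
      simp [hψdef, hv, hx, (Real.exp_pos _).le]
    obtain ⟨N, hN⟩ := ENNReal.exists_nat_mul_gt hne (ENNReal.ofReal_ne_top (r := Real.log (K / c)))
    exact absurd (h1 N) (not_le.2 hN)
  have hpos : ∀ᵐ x ∂μ, 0 < w x := by
    have : ∀ᵐ x ∂μ, w x ≠ 0 := by simpa [ae_iff] using hzero
    filter_upwards [this] with x hx using lt_of_le_of_ne (hw0 x) (Ne.symm hx)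
  refine ⟨?_, hzero⟩
  have hneg : Integrable (fun x => -Real.log (min (w x) 1)) μ := by
    have hlim : ∀ᵐ x ∂μ, Tendsto (fun N => ψ N x) atTop (𝓝 (-Real.log (min (w x) 1))) := by
      filter_upwards [hpos] with x hx
      have hm : 0 < min (w x) 1 := lt_min hx one_pos
      obtain ⟨N₀, hN₀⟩ := exists_nat_ge (-Real.log (min (w x) 1))
      refine tendsto_const_nhds.congr' ?_
      filter_upwards [eventually_ge_atTop N₀] with N hN
      simp only [hψdef, hv]
      rw [max_eq_right]
      rw [← Real.le_log_iff_exp_le hm]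
      have : (N₀ : ℝ) ≤ N := by exact_mod_cast hN
      linarith
    refine ⟨aestronglyMeasurable_of_tendsto_ae _ hψm hlim, ?_⟩
    calc ∫⁻ x, ‖-Real.log (min (w x) 1)‖ₑ ∂μ
        = ∫⁻ x, liminf (fun N => ‖ψ N x‖ₑ) atTop ∂μ :=
          lintegral_congr_ae (by filter_upwards [hlim] with x hx using hx.enorm.liminf_eq.symm)
      _ ≤ liminf (fun N => ∫⁻ x, ‖ψ N x‖ₑ ∂μ) atTop :=
          lintegral_liminf_le' fun N => (hψm N).aemeasurable.enorm
      _ ≤ ENNReal.ofReal (Real.log (K / c)) := by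
          refine liminf_le_of_le (by isBoundedDefault) fun b hb => ?_
          obtain ⟨N, hN⟩ := hb.exists
          refine hN.trans ((lintegral_mono fun x => ?_).trans (hlint N))
          rw [Real.enorm_of_nonneg (hψ0 N x)]
      _ < ⊤ := ENNReal.ofReal_lt_top
  refine (hneg.add hw).mono' hw.1.aemeasurable.log.aestronglyMeasurable ?_
  filter_upwards [hpos] with x hx
  simp only [Pi.add_apply, Real.norm_eq_abs]
  rcases le_total (w x) 1 with h1 | h1
  · rw [min_eq_left h1, abs_of_nonpos (Real.log_nonpos hx.le h1)]; linarith
  · rw [min_eq_right h1, abs_of_nonneg (Real.log_nonneg h1), Real.log_one]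
    linarith [Real.log_le_sub_one_of_pos hx]

end GeometricMean

noncomputable section Torus

open UnitAddTorus Submodule
open scoped ComplexConjugate

/-- The Haar probability measure on `ℝ / ℤ`. -/
local instance haarMeasureSpace : MeasureSpace UnitAddCircle := ⟨AddCircle.haarAddCircle⟩

local instance isAddHaarMeasure_volume :
    Measure.IsAddHaarMeasure (volume : Measure UnitAddCircle) :=
  inferInstanceAs (Measure.IsAddHaarMeasure AddCircle.haarAddCircle)

local instance isProbabilityMeasure_volume :
    IsProbabilityMeasure (volume : Measure UnitAddCircle) :=
  inferInstanceAs (IsProbabilityMeasure AddCircle.haarAddCircle)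

/-- Integration of continuous functions against a fixed integrable function. -/
def integralMulCLM {X : Type*} [TopologicalSpace X] [CompactSpace X] [MeasurableSpace X]
    [OpensMeasurableSpace X] {μ : Measure X} {f : X → ℂ} (hf : Integrable f μ) : C(X, ℂ) →L[ℂ] ℂ :=
  have hi (g : C(X, ℂ)) : Integrable (fun x => g x * f x) μ :=
    hf.bdd_mul (c := ‖g‖) g.continuous.measurable.aestronglyMeasurable
      (Eventually.of_forall g.norm_coe_le_norm)
  LinearMap.mkContinuous
    { toFun := fun g => ∫ x, g x * f x ∂μ
      map_add' := fun g h => by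
        simp only [ContinuousMap.add_apply, add_mul]
        exact integral_add (hi g) (hi h)
      map_smul' := fun c g => by
        simp only [ContinuousMap.smul_apply, smul_eq_mul, mul_assoc, RingHom.id_apply]
        exact integral_const_mul _ _ }
    (∫ x, ‖f x‖ ∂μ) fun g => by
      refine (norm_integral_le_integral_norm _).trans ?_
      rw [mul_comm, ← integral_const_mul]
      refine integral_mono (hi g).norm (hf.norm.const_mul _) fun x => ?_
      simp only [norm_mul]
      gcongr
      exact g.norm_coe_le_norm x

theorem integralMulCLM_apply {X : Type*} [TopologicalSpace X] [CompactSpace X] [MeasurableSpace X]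
    [OpensMeasurableSpace X] {μ : Measure X} {f : X → ℂ} (hf : Integrable f μ) (g : C(X, ℂ)) :
    integralMulCLM hf g = ∫ x, g x * f x ∂μ :=
  rfl

theorem integral_mFourier {ι : Type*} [Fintype ι] {n : ι → ℤ} (hn : n ≠ 0) :
    ∫ x, mFourier n x = 0 := by
  have h := (orthonormal_iff_ite.1 (orthonormal_mFourier (d := ι))) 0 n
  rw [if_neg hn.symm, ContinuousMap.inner_toLp] at h
  simpa [mFourier_zero] using h

/-- An integrable function on the torus with vanishing Fourier coefficients is zero. -/
theorem ae_eq_zero_of_mFourierCoeff_eq_zero {ι : Type*} [Fintype ι] {f : UnitAddTorus ι → ℂ}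
    (hf : Integrable f) (h : ∀ n, mFourierCoeff f n = 0) : f =ᵐ[volume] 0 := by
  have hker : (integralMulCLM hf).toLinearMap.ker = ⊤ := by
    rw [eq_top_iff, ← span_mFourier_closure_eq_top]
    refine topologicalClosure_minimal _ (span_le.2 ?_) (integralMulCLM hf).isClosed_ker
    rintro _ ⟨n, rfl⟩
    have := h (-n)
    rw [mFourierCoeff, neg_neg] at this
    exact this
  refine ae_eq_zero_of_forall_integral_continuousMap_mul_eq_zero hf fun g => ?_
  have hg : (⟨fun x => (g x : ℂ), by fun_prop⟩ : C(UnitAddTorus ι, ℂ)) ∈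
      (integralMulCLM hf).toLinearMap.ker := hker ▸ mem_top
  exact hg

variable {ι : Type*} [Fintype ι] [LinearOrder ι]

variable (ι) in
/-- Trigonometric polynomials whose frequencies are lexicographically positive. -/
def positiveSpan : Submodule ℂ C(UnitAddTorus ι, ℂ) :=
  span ℂ (mFourier '' {n | 0 < toLex n})

theorem mFourier_mem_positiveSpan {n : ι → ℤ} (hn : 0 < toLex n) :
    mFourier n ∈ positiveSpan ι :=
  subset_span ⟨n, hn, rfl⟩

theorem mul_mem_positiveSpan {g h : C(UnitAddTorus ι, ℂ)} (hg : g ∈ positiveSpan ι)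
    (hh : h ∈ positiveSpan ι) : g * h ∈ positiveSpan ι := by
  have : g * h ∈ positiveSpan ι * positiveSpan ι := mul_mem_mul hg hh
  rw [positiveSpan, span_mul_span] at this
  refine span_mono ?_ this
  rintro _ ⟨_, ⟨m, hm, rfl⟩, _, ⟨n, hn, rfl⟩, rfl⟩
  refine ⟨m + n, ?_, ?_⟩
  · exact add_pos (α := Lex (ι → ℤ)) hm hn
  · ext x
    exact mFourier_add

theorem pow_succ_mem_positiveSpan {g : C(UnitAddTorus ι, ℂ)} (hg : g ∈ positiveSpan ι) (k : ℕ) :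
    g ^ (k + 1) ∈ positiveSpan ι := by
  induction k with
  | zero => simpa using hg
  | succ k ih => exact pow_succ g (k + 1) ▸ mul_mem_positiveSpan ih hg

/-- Every trigonometric polynomial splits into its mean, a lexicographically positive part and the
conjugate of another one. -/
theorem exists_positiveSpan_decomposition {g : C(UnitAddTorus ι, ℂ)}
    (hg : g ∈ span ℂ (Set.range (mFourier (d := ι)))) :
    ∃ h₁ ∈ positiveSpan ι, ∃ h₂ ∈ positiveSpan ι,
      ∀ x, g x = (∫ y, g y) + h₁ x + conj (h₂ x) := by
  have hi (g : C(UnitAddTorus ι, ℂ)) : Integrable (fun x => g x) :=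
    Integrable.of_bound g.continuous.measurable.aestronglyMeasurable ‖g‖
      (Eventually.of_forall g.norm_coe_le_norm)
  induction hg using span_induction with
  | mem g hg =>
    obtain ⟨n, rfl⟩ := hg
    rcases lt_trichotomy (toLex n) 0 with hn | hn | hn
    · refine ⟨0, zero_mem _, mFourier (-n), mFourier_mem_positiveSpan ?_, fun x => ?_⟩
      · exact (neg_pos (a := toLex n)).2 hn
      · rw [integral_mFourier (by rintro rfl; exact lt_irrefl _ hn), mFourier_neg]
        simp
    · obtain rfl : n = 0 := hn
      exact ⟨0, zero_mem _, 0, zero_mem _, fun x => by simp [mFourier_zero]⟩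
    · refine ⟨mFourier n, mFourier_mem_positiveSpan hn, 0, zero_mem _, fun x => ?_⟩
      rw [integral_mFourier (by rintro rfl; exact lt_irrefl _ hn)]
      simp
  | zero => exact ⟨0, zero_mem _, 0, zero_mem _, fun x => by simp⟩
  | add g g' _ _ ihg ihg' =>
    obtain ⟨h₁, hh₁, h₂, hh₂, h⟩ := ihg
    obtain ⟨h₁', hh₁', h₂', hh₂', h'⟩ := ihg'
    refine ⟨h₁ + h₁', add_mem hh₁ hh₁', h₂ + h₂', add_mem hh₂ hh₂', fun x => ?_⟩
    simp only [ContinuousMap.add_apply, map_add]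
    rw [integral_add (hi g) (hi g'), h x, h' x]
    ring
  | smul c g _ ih =>
    obtain ⟨h₁, hh₁, h₂, hh₂, h⟩ := ih
    refine ⟨c • h₁, smul_mem _ _ hh₁, conj c • h₂, smul_mem _ _ hh₂, fun x => ?_⟩
    simp only [ContinuousMap.smul_apply, smul_eq_mul, map_mul, Complex.conj_conj]
    rw [integral_const_mul, h x]
    ring

/-- If `f` has no lexicographically negative frequencies, then multiplying it by the exponential
of a lexicographically positive polynomial does not change its mean. -/
theorem integral_exp_mul_eq {f : UnitAddTorus ι → ℂ} (hf : Integrable f)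
    (hneg : ∀ n, toLex n < 0 → mFourierCoeff f n = 0) {h : C(UnitAddTorus ι, ℂ)}
    (hh : h ∈ positiveSpan ι) : ∫ x, Complex.exp (h x) * f x = ∫ x, f x := by
  have hker : positiveSpan ι ≤ (integralMulCLM hf).toLinearMap.ker := by
    refine span_le.2 ?_
    rintro _ ⟨n, hn, rfl⟩
    have := hneg (-n) ((neg_neg_iff_pos (a := toLex n)).2 hn)
    rw [mFourierCoeff, neg_neg] at this
    exact this
  have hsum := (NormedSpace.exp_series_hasSum_exp' (𝕂 := ℂ) h).mapL (integralMulCLM hf)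
  have hsum' := hasSum_single (f := fun n : ℕ =>
    integralMulCLM hf ((n.factorial⁻¹ : ℂ) • h ^ n)) 0 fun n hn => by
      obtain ⟨k, rfl⟩ := Nat.exists_eq_succ_of_ne_zero hn
      exact hker (smul_mem _ _ (pow_succ_mem_positiveSpan hh k))
  have heq := hsum.unique hsum'
  rw [NormedSpace.exp_continuousMap_eq] at heq
  simpa [integralMulCLM_apply, ← Complex.exp_eq_exp_ℂ] using heq

/-- A lower bound for the geometric mean of a function by its lexicographically first Fourier
coefficient, in dual form. -/
theorem norm_mFourierCoeff_mul_exp_integral_le {f : UnitAddTorus ι → ℂ} (hf : Integrable f)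
    {α : ι → ℤ} (hα : ∀ n, toLex n < toLex α → mFourierCoeff f n = 0) {ψ : UnitAddTorus ι → ℝ}
    {C : ℝ} (hψ : AEStronglyMeasurable ψ) (hC : ∀ x, |ψ x| ≤ C) :
    ‖mFourierCoeff f α‖ * Real.exp (∫ x, ψ x) ≤ ∫ x, ‖f x‖ * Real.exp (ψ x) := by
  have hi (g : C(UnitAddTorus ι, ℂ)) : Integrable (fun x => g x) :=
    Integrable.of_bound g.continuous.measurable.aestronglyMeasurable ‖g‖
      (Eventually.of_forall g.norm_coe_le_norm)
  have hpoly (g : C(UnitAddTorus ι, ℂ)) (hg : g ∈ span ℂ (Set.range (mFourier (d := ι)))) :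
      ‖mFourierCoeff f α‖ * Real.exp (∫ x, (g x).re) ≤ ∫ x, ‖f x‖ * Real.exp (g x).re := by
    obtain ⟨h₁, hh₁, h₂, hh₂, hdec⟩ := exists_positiveSpan_decomposition hg
    have hre (x) : ((h₁ + h₂) x).re = (g x).re - ∫ y, (g y).re := by
      have h1 : ∫ y, (g y).re = (∫ y, g y).re := integral_re (hi g)
      rw [h1, hdec x]
      simp only [ContinuousMap.add_apply, Complex.add_re, Complex.conj_re]
      ring
    have hf' : Integrable fun x => mFourier (-α) x * f x :=
      hf.bdd_mul (c := ‖mFourier (-α)‖) (mFourier (-α)).continuous.measurable.aestronglyMeasurable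
        (Eventually.of_forall (mFourier (-α)).norm_coe_le_norm)
    have hneg (n : ι → ℤ) (hn : toLex n < 0) :
        mFourierCoeff (fun x => mFourier (-α) x * f x) n = 0 := by
      rw [← hα (n + α) (by simpa using add_lt_add_left hn (toLex α))]
      simp only [mFourierCoeff, smul_eq_mul, neg_add, mFourier_add, mul_assoc]
    have hmean : ∫ x, Complex.exp ((h₁ + h₂) x) * (mFourier (-α) x * f x) = mFourierCoeff f α :=
      integral_exp_mul_eq hf' hneg (add_mem hh₁ hh₂)
    have hnorm (x) : ‖mFourier (-α) x‖ = 1 := by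
      simp only [mFourier, fourier_apply, ContinuousMap.coe_mk, norm_prod, Circle.norm_coe,
        Finset.prod_const_one]
    rw [← hmean, ← le_div_iff₀ (Real.exp_pos _), ← integral_div]
    refine (norm_integral_le_integral_norm _).trans_eq ?_
    congr 1 with x
    rw [norm_mul, norm_mul, hnorm, Complex.norm_exp, hre, Real.exp_sub]
    ring
  have hcont (g : C(UnitAddTorus ι, ℝ)) :
      ‖mFourierCoeff f α‖ * Real.exp (∫ x, g x) ≤ ∫ x, ‖f x‖ * Real.exp (g x) := by
    set G : C(UnitAddTorus ι, ℂ) := ⟨fun x => (g x : ℂ), by fun_prop⟩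
    have hG : G ∈ (span ℂ (Set.range (mFourier (d := ι)))).topologicalClosure :=
      span_mFourier_closure_eq_top (d := ι) ▸ mem_top
    obtain ⟨p, hp, hlim⟩ := mem_closure_iff_seq_limit.1 hG
    obtain ⟨B, hB⟩ := (Metric.isBounded_range_of_tendsto _ hlim).exists_norm_le
    refine mul_exp_integral_le_of_tendsto (C := B) hf.norm (g := fun n x => (p n x).re)
      (fun n => ?_) (fun n x => ?_) (Eventually.of_forall fun x => ?_) fun n => hpoly _ (hp n)
    · exact (Complex.continuous_re.comp (p n).continuous).measurable.aestronglyMeasurable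
    · exact (Complex.abs_re_le_norm _).trans (((p n).norm_coe_le_norm x).trans
        (hB _ (Set.mem_range_self n)))
    · exact (Complex.continuous_re.tendsto _).comp
        (((ContinuousEvalConst.continuous_eval_const x).tendsto G).comp hlim)
  obtain ⟨g, hgb, hg⟩ := exists_seq_continuousMap_tendsto_ae hψ hC
  exact mul_exp_integral_le_of_tendsto hf.norm
    (fun n => (g n).continuous.measurable.aestronglyMeasurable) hgb hg fun n => hcont (g n)

/-- A nonempty set of multi-indices without negative entries has a lexicographically least
element. -/
theorem exists_toLex_minimal {s : Set (ι → ℤ)} (hs : s.Nonempty) (hnonneg : ∀ n ∈ s, ∀ j, 0 ≤ n j) :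
    ∃ α ∈ s, ∀ n, toLex n < toLex α → n ∉ s := by
  let t : Set (Lex (ι → ℕ)) := {m | (fun j => (ofLex m j : ℤ)) ∈ s}
  have hlift (n) (hn : n ∈ s) : (fun j => (((n j).toNat : ℕ) : ℤ)) = n :=
    funext fun j => Int.toNat_of_nonneg (hnonneg n hn j)
  have ht : t.Nonempty := by
    obtain ⟨n, hn⟩ := hs
    refine ⟨toLex fun j => (n j).toNat, ?_⟩
    change (fun j => (((n j).toNat : ℕ) : ℤ)) ∈ s
    rwa [hlift n hn]
  obtain ⟨m, hm, hmin⟩ := (wellFounded_lt (α := Lex (ι → ℕ))).has_min t ht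
  refine ⟨_, hm, fun n hlt hn => hmin (toLex fun j => (n j).toNat) ?_ ?_⟩
  · change (fun j => (((n j).toNat : ℕ) : ℤ)) ∈ s
    rwa [hlift n hn]
  · obtain ⟨i, hi, hi'⟩ := hlt
    refine ⟨i, fun j hj => ?_, ?_⟩
    · have := hi j hj
      have h0 := hnonneg n hn j
      change n j = ((ofLex m j : ℕ) : ℤ) at this
      change (n j).toNat = ofLex m j
      omega
    · have h0 := hnonneg n hn i
      change n i < ((ofLex m i : ℕ) : ℤ) at hi'
      change (n i).toNat < ofLex m i
      omega

/-- A nonzero function in the Hardy space `H¹` of the torus is log-integrable and almost everywhere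
nonzero. -/
theorem integrable_log_norm_of_mFourierCoeff_eq_zero {f : UnitAddTorus ι → ℂ} (hf : Integrable f)
    (hneg : ∀ n : ι → ℤ, (∃ j, n j < 0) → mFourierCoeff f n = 0) (hne : ¬ f =ᵐ[volume] 0) :
    Integrable (fun x => Real.log ‖f x‖) ∧ volume {x | f x = 0} = 0 := by
  have hs : {n | mFourierCoeff f n ≠ 0}.Nonempty := by
    by_contra hempty
    exact hne (ae_eq_zero_of_mFourierCoeff_eq_zero hf fun n => by
      by_contra hn
      exact hempty ⟨n, hn⟩)
  obtain ⟨α, hα, hmin⟩ := exists_toLex_minimal hs fun n hn j => by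
    by_contra! hj
    exact hn (hneg n ⟨j, hj⟩)
  have h := integrable_log_of_mul_exp_integral_le hf.norm (fun x => norm_nonneg _)
    (norm_pos_iff.2 hα) fun ψ C hψ hC => norm_mFourierCoeff_mul_exp_integral_le hf
      (fun n hn => by simpa using hmin n hn) hψ hC
  simpa using h

/-- The representative in `(0,1]^ι` of a point of the torus. -/
def torusLift (ι : Type*) : UnitAddTorus ι → ι → ℝ :=
  Subtype.val ∘ measurableEquivPiIoc (0 : ι → ℝ)

theorem coe_torusLift (ι : Type*) (x : UnitAddTorus ι) :
    (fun i => (torusLift ι x i : UnitAddCircle)) = x :=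
  (measurableEquivPiIoc (0 : ι → ℝ)).symm_apply_apply x

theorem torusBox_eq (d : ℕ) :
    torusBox d = {x | ∀ i, x i ∈ Set.Ioc ((0 : Fin d → ℝ) i) ((0 : Fin d → ℝ) i + 1)} := by
  ext x
  simp [torusBox]

theorem measurableSet_torusBox (d : ℕ) : MeasurableSet (torusBox d) :=
  MeasurableSet.univ_pi fun _ => measurableSet_Ioc

theorem measurableEmbedding_torusLift (d : ℕ) : MeasurableEmbedding (torusLift (Fin d)) :=
  (MeasurableEmbedding.subtype_coe (MeasurableSet.univ_pi' fun _ => measurableSet_Ioc)).comp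
    (measurableEquivPiIoc 0).measurableEmbedding

theorem measurePreserving_torusLift (d : ℕ) :
    MeasurePreserving (torusLift (Fin d)) volume (volume.restrict (torusBox d)) := by
  rw [torusBox_eq]
  exact (measurePreserving_subtype_coe (MeasurableSet.univ_pi' fun _ => measurableSet_Ioc)).comp
    (measurePreserving_equivPiIoc 0)

theorem mFourier_neg_eq_exp {ι : Type*} [Fintype ι] (n : ι → ℤ) (x : UnitAddTorus ι) :
    mFourier (-n) x =
      Complex.exp (-(2 * Real.pi * Complex.I * ∑ j, (n j : ℂ) * (torusLift ι x j : ℂ))) := by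
  conv_lhs => rw [← coe_torusLift ι x]
  simp only [mFourier, ContinuousMap.coe_mk, fourier_coe_apply, ← Complex.exp_sum]
  congr 1
  rw [Finset.mul_sum, ← Finset.sum_neg_distrib]
  refine Finset.sum_congr rfl fun j _ => ?_
  simp
  ring

theorem integrableOn_log_norm_torusBox (d : ℕ) (φ : (Fin d → ℝ) → ℂ)
    (hint : IntegrableOn φ (torusBox d))
    (hhardy : ∀ α : Fin d → ℤ, (∃ j, α j < 0) →
      ∫ θ in torusBox d,
        φ θ * Complex.exp (-(2 * Real.pi * Complex.I * ∑ j, (α j : ℂ) * (θ j : ℂ))) = 0)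
    (hnontriv : ¬ (∀ᵐ θ ∂volume.restrict (torusBox d), φ θ = 0)) :
    IntegrableOn (fun θ => Real.log ‖φ θ‖) (torusBox d)
      ∧ volume {θ ∈ torusBox d | φ θ = 0} = 0 := by
  have hmp := measurePreserving_torusLift d
  have hemb := measurableEmbedding_torusLift d
  obtain ⟨hlog, hzero⟩ := integrable_log_norm_of_mFourierCoeff_eq_zero
    (f := φ ∘ torusLift (Fin d)) ((hmp.integrable_comp_emb hemb).2 hint) (fun n hn => by
      rw [← hhardy n hn, ← hmp.integral_comp hemb]
      simp only [mFourierCoeff, mFourier_neg_eq_exp, smul_eq_mul, Function.comp_apply, mul_comm])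
    (fun h => hnontriv (by
      rw [← hmp.map_eq, hemb.ae_map_iff]
      exact h))
  refine ⟨(hmp.integrable_comp_emb hemb).1 hlog, ?_⟩
  have hset : {θ ∈ torusBox d | φ θ = 0} = {θ | φ θ = 0} ∩ torusBox d := by
    ext θ
    exact and_comm
  rw [hset, ← Measure.restrict_apply' (measurableSet_torusBox d), ← hmp.map_eq, hemb.map_apply]
  exact hzero

end Torus

theorem stmt_18 (d : ℕ) (hd : 1 ≤ d) (φ : (Fin d → ℝ) → ℂ)
    (hint : IntegrableOn φ (torusBox d))
    (hhardy : ∀ α : Fin d → ℤ, (∃ j, α j < 0) →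
      ∫ θ in torusBox d,
        φ θ * Complex.exp (-(2 * Real.pi * Complex.I * ∑ j, (α j : ℂ) * (θ j : ℂ))) = 0)
    (hnontriv : ¬ (∀ᵐ θ ∂volume.restrict (torusBox d), φ θ = 0)) :
    IntegrableOn (fun θ => Real.log ‖φ θ‖) (torusBox d)
      ∧ volume {θ ∈ torusBox d | φ θ = 0} = 0 := by
  exact integrableOn_log_norm_torusBox d φ hint hhardy hnontriv
end
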